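/- arXiv:2005.08779 — 2 statements merged into one kernel-verified Lean document; each statement's English description precedes it below -/
import Mathlib

section
/- Let A be a short local artin algebra of Hilbert type (e, a) which is not self-injective, and let Q_• = (Q_i, d_i : Q_i → Q_{i−1})_{i∈ℤ} be an acyclic minimal complex of finitely generated projective A-modules. Let N_i denote the image of d_i, and assume that at least one of the modules N_i is semi-Gorenstein-projective. Then all the projective modules Q_i have the same rank, say t, and dim N_j = (t, at) for all j ∈ ℤ. -/
/-!
Common background: `A` is an artin algebra (an algebra over a commutative artinian
ring `k`, finitely generated as `k`-module).  Left `A`-modules are `Module A M`;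
right `A`-modules are `Module Aᵐᵒᵖ N`.  `Dl A M = Hom_A(M,A)` is the `A`-dual of a
left module (a right module) and `Dr A N` the dual of a right module (a left module);
`evalL A M : M → M**` is the canonical evaluation map `φ_M`.
-/

open CategoryTheory LinearMap

universe u

section Preliminaries

variable (A : Type u) [Ring A]

/-- The `A`-dual of a left `A`-module: `M* = Hom_A(M, A)`, a right `A`-module. -/
abbrev Dl (M : Type u) [AddCommGroup M] [Module A M] : Type u := M →ₗ[A] A

/-- The `A`-dual of a right `A`-module: a left `A`-module. -/
abbrev Dr (N : Type u) [AddCommGroup N] [Module Aᵐᵒᵖ N] : Type u := N →ₗ[Aᵐᵒᵖ] A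

variable {A}

/-- The dual of a map of left modules. -/
def dualMapL {M N : Type u} [AddCommGroup M] [Module A M] [AddCommGroup N] [Module A N]
    (g : M →ₗ[A] N) : Dl A N →ₗ[Aᵐᵒᵖ] Dl A M where
  toFun h := h.comp g
  map_add' h₁ h₂ := by ext; simp
  map_smul' a h := by ext; simp

/-- The dual of a map of right modules. -/
def dualMapR {M N : Type u} [AddCommGroup M] [Module Aᵐᵒᵖ M] [AddCommGroup N] [Module Aᵐᵒᵖ N]
    (g : M →ₗ[Aᵐᵒᵖ] N) : Dr A N →ₗ[A] Dr A M where
  toFun h := h.comp g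
  map_add' h₁ h₂ := by ext; simp
  map_smul' a h := by ext; simp

variable (A)

/-- The canonical evaluation map `φ_M : M → M**` for a left module `M`. -/
def evalL (M : Type u) [AddCommGroup M] [Module A M] : M →ₗ[A] Dr A (Dl A M) where
  toFun m :=
    { toFun := fun f => f m
      map_add' := fun f g => rfl
      map_smul' := fun a f => rfl }
  map_add' m m' := by ext f; simp
  map_smul' a m := by ext f; simp

/-- The canonical evaluation map `φ_N : N → N**` for a right module `N`. -/
def evalR (N : Type u) [AddCommGroup N] [Module Aᵐᵒᵖ N] : N →ₗ[Aᵐᵒᵖ] Dl A (Dr A N) where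
  toFun n :=
    { toFun := fun f => f n
      map_add' := fun f g => rfl
      map_smul' := fun a f => rfl }
  map_add' n n' := by ext f; simp
  map_smul' a n := by ext f; simp

/-- The radical of a module: the intersection of all maximal submodules. -/
def radM (M : Type u) [AddCommGroup M] [Module A M] : Submodule A M :=
  sInf {N : Submodule A M | IsCoatom N}

/-- A module is *reduced* if it has no nonzero projective direct summand. -/
def Reduced (M : Type u) [AddCommGroup M] [Module A M] : Prop :=
  ∀ N N' : Submodule A M, IsCompl N N' → Module.Projective A N → N = ⊥

/-- Vanishing of `Ext^i_A(M, N)`. -/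
def extZero (M N : Type u) [AddCommGroup M] [Module A M] [AddCommGroup N] [Module A N]
    (i : ℕ) : Prop :=
  Limits.IsZero (((Ext ℤ (ModuleCat.{u} A) i).obj (Opposite.op (ModuleCat.of A M))).obj
    (ModuleCat.of A N))

/-- A left module `M` is semi-Gorenstein-projective if `Ext^i_A(M, A) = 0` for all `i ≥ 1`. -/
def sGp (M : Type u) [AddCommGroup M] [Module A M] : Prop :=
  ∀ i : ℕ, 1 ≤ i → extZero A M A i

/-- Semi-Gorenstein-projectivity for right modules, with `A` as right regular module. -/
def sGpR (N : Type u) [AddCommGroup N] [Module Aᵐᵒᵖ N] : Prop :=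
  ∀ i : ℕ, 1 ≤ i → extZero Aᵐᵒᵖ N A i

/-- `e : P → M` is a projective cover: `P` is a finitely generated projective module,
`e` is surjective and `ker e ⊆ rad P`. -/
def IsProjCover {P M : Type u} [AddCommGroup P] [Module A P] [AddCommGroup M] [Module A M]
    (e : P →ₗ[A] M) : Prop :=
  Module.Projective A P ∧ Module.Finite A P ∧ Function.Surjective e ∧ ker e ≤ radM A P

/-- `P₁ →f P₀ →e M → 0` is a minimal projective presentation of `M`. -/
def IsMinPres {P₁ P₀ M : Type u} [AddCommGroup P₁] [Module A P₁] [AddCommGroup P₀] [Module A P₀]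
    [AddCommGroup M] [Module A M] (f : P₁ →ₗ[A] P₀) (e : P₀ →ₗ[A] M) : Prop :=
  IsProjCover A e ∧ range f = ker e ∧ Module.Projective A P₁ ∧ Module.Finite A P₁ ∧
    ker f ≤ radM A P₁

/-- A minimal projective resolution `⋯ → P₁ → P₀ → M → 0` (ℕ-indexed). -/
def IsMinProjRes (P : ℕ → Type u) [∀ n, AddCommGroup (P n)] [∀ n, Module A (P n)]
    {M : Type u} [AddCommGroup M] [Module A M]
    (f : ∀ n, P (n+1) →ₗ[A] P n) (e : P 0 →ₗ[A] M) : Prop :=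
  (∀ n, Module.Projective A (P n)) ∧ (∀ n, Module.Finite A (P n)) ∧
    Function.Surjective e ∧ range (f 0) = ker e ∧ (∀ n, range (f (n+1)) = ker (f n)) ∧
    ker e ≤ radM A (P 0) ∧ (∀ n, ker (f n) ≤ radM A (P (n+1)))

section ZComplex

variable (P : ℤ → Type u) [∀ i, AddCommGroup (P i)] [∀ i, Module A (P i)]
  (g : ∀ i : ℤ, P i →ₗ[A] P (i-1))

/-- `(P_i, g_i : P_i → P_{i-1})` is a complex. -/
def IsComplexZ : Prop := ∀ i : ℤ, (g (i-1)).comp (g i) = 0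

/-- A complex is minimal if each image lies in the radical. -/
def IsMinimalZ : Prop := ∀ i : ℤ, range (g i) ≤ radM A (P (i-1))

/-- A complex of (finitely generated) projective modules. -/
def IsProjComplexZ : Prop := ∀ i : ℤ, Module.Projective A (P i) ∧ Module.Finite A (P i)

/-- Exactness at position `i - 1`, i.e. `H_{i-1}(P_•) = 0`. -/
def ExactAtPred (i : ℤ) : Prop := range (g i) = ker (g (i-1))

/-- Acyclicity of the `A`-dual complex `P_•^*`. -/
def DualAcyclicZ : Prop :=
  ∀ i : ℤ, range (dualMapL (g (i-1))) = ker (dualMapL (g i))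

/-- The homology of the complex at position `i - 1`. -/
abbrev HomologyAtPred (i : ℤ) : Type u :=
  ↥(ker (g (i-1))) ⧸ (Submodule.comap (ker (g (i-1))).subtype (range (g i)))

end ZComplex

/-- `Z` is (a representative of) the transpose `Tr M` of the left module `M`. -/
def IsTrL (M : Type u) [AddCommGroup M] [Module A M]
    (Z : Type u) [AddCommGroup Z] [Module Aᵐᵒᵖ Z] : Prop :=
  ∃ (P₁ P₀ : ModuleCat.{u} A) (f : P₁ →ₗ[A] P₀) (e : P₀ →ₗ[A] M),
    IsMinPres A f e ∧ Nonempty (Z ≃ₗ[Aᵐᵒᵖ] (Dl A P₁ ⧸ range (dualMapL f)))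

/-- `M` is (a representative of) the transpose `Tr Z` of the right module `Z`. -/
def IsTrR (Z : Type u) [AddCommGroup Z] [Module Aᵐᵒᵖ Z]
    (M : Type u) [AddCommGroup M] [Module A M] : Prop :=
  ∃ (Q₁ Q₀ : ModuleCat.{u} Aᵐᵒᵖ) (d : Q₁ →ₗ[Aᵐᵒᵖ] Q₀) (c : Q₀ →ₗ[Aᵐᵒᵖ] Z),
    IsMinPres Aᵐᵒᵖ d c ∧ Nonempty (M ≃ₗ[A] (Dr A Q₁ ⧸ range (dualMapR d)))

/-- `W` is (a representative of) the syzygy `Ω M` of the left module `M`. -/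
def IsSyzL (W M : Type u) [AddCommGroup W] [Module A W] [AddCommGroup M] [Module A M] : Prop :=
  ∃ (P : ModuleCat.{u} A) (e : P →ₗ[A] M),
    IsProjCover A e ∧ Nonempty (W ≃ₗ[A] ker e)

/-- `W` is (a representative of) the syzygy `Ω Z` of the right module `Z`. -/
def IsSyzR (W Z : Type u) [AddCommGroup W] [Module Aᵐᵒᵖ W] [AddCommGroup Z] [Module Aᵐᵒᵖ Z] :
    Prop :=
  ∃ (Q : ModuleCat.{u} Aᵐᵒᵖ) (c : Q →ₗ[Aᵐᵒᵖ] Z),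
    IsProjCover Aᵐᵒᵖ c ∧ Nonempty (W ≃ₗ[Aᵐᵒᵖ] ker c)

/-- `W` is a second syzygy `Ω² M`. -/
def IsSyz2L (W M : Type u) [AddCommGroup W] [Module A W] [AddCommGroup M] [Module A M] : Prop :=
  ∃ (V : ModuleCat.{u} A), IsSyzL A V M ∧ IsSyzL A W V

/-- `W` is a second syzygy `Ω² Z` of a right module. -/
def IsSyz2R (W Z : Type u) [AddCommGroup W] [Module Aᵐᵒᵖ W] [AddCommGroup Z] [Module Aᵐᵒᵖ Z] :
    Prop :=
  ∃ (V : ModuleCat.{u} Aᵐᵒᵖ), IsSyzR A V Z ∧ IsSyzR A W V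

/-- A right module `Z` is ∞-torsionfree if its transpose is semi-Gorenstein-projective. -/
def InfTfR (Z : Type u) [AddCommGroup Z] [Module Aᵐᵒᵖ Z] : Prop :=
  ∃ (M : ModuleCat.{u} A), IsTrR A Z M ∧ sGp A M

/-- A left module `M` is ∞-torsionfree if its transpose is semi-Gorenstein-projective. -/
def InfTfL (M : Type u) [AddCommGroup M] [Module A M] : Prop :=
  ∃ (Z : ModuleCat.{u} Aᵐᵒᵖ), IsTrL A M Z ∧ sGpR A Z

/-- Projective dimension at most `n` (for objects of `ModuleCat A`). -/
def projDimLEcat : ℕ → ModuleCat.{u} A → Prop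
  | 0, M => Module.Projective A M
  | (n+1), M => ∃ (P : ModuleCat.{u} A) (e : P →ₗ[A] M),
      Module.Projective A P ∧ Module.Finite A P ∧ Function.Surjective e ∧
        projDimLEcat n (ModuleCat.of A (ker e))

/-- Projective dimension at most `n`. -/
def projDimLE (M : Type u) [AddCommGroup M] [Module A M] (n : ℕ) : Prop :=
  projDimLEcat A n (ModuleCat.of A M)

/-- A Nunke module: a semi-Gorenstein-projective module `M` with `M* = 0`. -/
def NunkeL (M : Type u) [AddCommGroup M] [Module A M] : Prop :=
  sGp A M ∧ ∀ f : Dl A M, f = 0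

end Preliminaries


/-- The length of a module, expressed as the Krull dimension of its submodule lattice. -/
noncomputable def lengthM (A : Type u) [Ring A] (M : Type u) [AddCommGroup M] [Module A M] :
    WithBot ℕ∞ :=
  Order.krullDim (Submodule A M)

/-- `I • N`, the submodule generated by products of elements of an ideal with elements
of a submodule. -/
def idealSMulSub (A : Type u) [Ring A] {Q : Type u} [AddCommGroup Q] [Module A Q]
    (I : Ideal A) (N : Submodule A Q) : Submodule A Q :=
  Submodule.span A {x | ∃ a ∈ I, ∃ n ∈ N, x = a • n}

/-- `t(N) = length of N/JN` where `J` is the radical of `A`. -/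
noncomputable def topLength (A : Type u) [Ring A] {Q : Type u} [AddCommGroup Q] [Module A Q]
    (N : Submodule A Q) : WithBot ℕ∞ :=
  lengthM A (↥N ⧸ Submodule.comap N.subtype (idealSMulSub A (Ideal.jacobson ⊥) N))

/-- `|JN| = length of JN`. -/
noncomputable def radLength (A : Type u) [Ring A] {Q : Type u} [AddCommGroup Q] [Module A Q]
    (N : Submodule A Q) : WithBot ℕ∞ :=
  lengthM A (↥(idealSMulSub A (Ideal.jacobson ⊥) N))

section LocalRing

variable {A : Type u} [Ring A] [IsLocalRing A]

theorem isUnit_of_mul_eq_one_of_isLocalRing {u x : A} (h : u * x = 1) : IsUnit x := by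
  have hid : x * u * (x * u) = x * u := by
    rw [mul_assoc, ← mul_assoc u, h, one_mul]
  rcases IsLocalRing.isUnit_or_isUnit_of_add_one (a := x * u) (b := 1 - x * u) (by simp) with
    h1 | h1
  · have : x * u = 1 := h1.mul_left_cancel (by rw [hid, mul_one])
    exact ⟨⟨x, u, this, h⟩, rfl⟩
  · have h0 : x * u = 0 := h1.mul_left_cancel (by rw [sub_mul, hid]; simp)
    have : (1 : A) = 0 := by
      calc (1 : A) = u * x * (u * x) := by rw [h, one_mul]
        _ = u * (x * u) * x := by simp only [mul_assoc]
        _ = 0 := by rw [h0]; simp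
    exact absurd this one_ne_zero

theorem isUnit_of_notMem_jacobson {x : A} (hx : x ∉ Ring.jacobson A) : IsUnit x := by
  by_contra hu
  apply hx
  rw [Ring.jacobson_eq_sInf_isMaximal, Submodule.mem_sInf]
  intro m hm
  by_contra hxm
  have hm' : Ideal.IsMaximal m := hm
  have htop : m ⊔ Ideal.span {x} = ⊤ := by
    apply hm'.out.2
    rw [left_lt_sup, Ideal.span_singleton_le_iff_mem]
    exact hxm
  obtain ⟨a, ha, b, hb, hab⟩ := Submodule.mem_sup.1 ((Ideal.eq_top_iff_one _).1 htop)
  obtain ⟨c, rfl⟩ := Ideal.mem_span_singleton'.1 hb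
  rcases IsLocalRing.isUnit_or_isUnit_of_add_one hab with h | h
  · exact hm'.ne_top (Ideal.eq_top_of_isUnit_mem _ ha h)
  · obtain ⟨v, hv⟩ := h.exists_left_inv
    rw [← mul_assoc] at hv
    exact hu (isUnit_of_mul_eq_one_of_isLocalRing hv)

theorem le_jacobson_of_ne_top {I : Ideal A} (hI : I ≠ ⊤) : I ≤ Ring.jacobson A := by
  intro x hx
  by_contra h
  exact hI (Ideal.eq_top_of_isUnit_mem _ hx (isUnit_of_notMem_jacobson h))

theorem eq_jacobson_of_isMaximal {m : Ideal A} (hm : m.IsMaximal) : m = Ring.jacobson A :=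
  le_antisymm (le_jacobson_of_ne_top hm.ne_top) (Ring.jacobson_le_of_isMaximal m)

variable (A) in
theorem isMaximal_jacobson : (Ring.jacobson A).IsMaximal := by
  obtain ⟨m, hm⟩ := Ideal.exists_maximal A
  rwa [← eq_jacobson_of_isMaximal hm]

instance isSimpleModule_quotient_jacobson : IsSimpleModule A (A ⧸ Ring.jacobson A) :=
  isSimpleModule_iff_quot_maximal.2 ⟨_, isMaximal_jacobson A, ⟨LinearEquiv.refl _ _⟩⟩

theorem nonempty_equiv_quotient_jacobson (M : Type*) [AddCommGroup M] [Module A M]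
    [IsSimpleModule A M] : Nonempty (M ≃ₗ[A] A ⧸ Ring.jacobson A) := by
  obtain ⟨m, hm, h⟩ := isSimpleModule_iff_quot_maximal.1 (inferInstance : IsSimpleModule A M)
  rwa [eq_jacobson_of_isMaximal hm] at h

end LocalRing

theorem idealSMulSub_eq_smul {A : Type u} [Ring A] {Q : Type u} [AddCommGroup Q] [Module A Q]
    (I : Ideal A) (N : Submodule A Q) : idealSMulSub A I N = I • N := by
  apply le_antisymm
  · refine Submodule.span_le.2 ?_
    rintro _ ⟨a, ha, n, hn, rfl⟩
    exact Submodule.smul_mem_smul ha hn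
  · exact Submodule.smul_le.2 fun a ha n hn => Submodule.subset_span ⟨a, ha, n, hn, rfl⟩

section Radical

variable {A : Type u} [Ring A] [IsArtinianRing A]

theorem isSemisimpleModule_quotient_jacobson_smul_top (M : Type*) [AddCommGroup M] [Module A M] :
    IsSemisimpleModule A (M ⧸ (Ring.jacobson A • ⊤ : Submodule A M)) := by
  have h : Module.IsTorsionBySet A (M ⧸ (Ring.jacobson A • ⊤ : Submodule A M))
      (Ring.jacobson A) := by
    rw [Module.isTorsionBySet_quotient_iff]
    exact fun m i hi => Submodule.smul_mem_smul hi trivial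
  let _ := h.module
  exact (h.semilinearMap.isSemisimpleModule_iff_of_bijective Function.bijective_id).2
      inferInstance

theorem radM_eq_jacobson_smul_top (M : Type u) [AddCommGroup M] [Module A M] :
    radM A M = Ring.jacobson A • (⊤ : Submodule A M) := by
  apply le_antisymm
  · have := isSemisimpleModule_quotient_jacobson_smul_top (A := A) M
    exact Module.jacobson_le_of_eq_bot (IsSemisimpleModule.jacobson_eq_bot A _)
  · exact Ring.jacobson_smul_top_le A M

theorem exists_linearMap_quotient_jacobson_ne_zero [IsLocalRing A] {M : Type u} [AddCommGroup M]
    [Module A M] {w : M} (hw : w ∉ (Ring.jacobson A • ⊤ : Submodule A M)) :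
    ∃ r : M →ₗ[A] A ⧸ Ring.jacobson A, r w ≠ 0 := by
  rw [← radM_eq_jacobson_smul_top, radM, Submodule.mem_sInf] at hw
  push Not at hw
  obtain ⟨U, hU, hwU⟩ := hw
  have : IsSimpleModule A (M ⧸ U) := isSimpleModule_iff_isCoatom.2 hU
  obtain ⟨e⟩ := nonempty_equiv_quotient_jacobson (A := A) (M ⧸ U)
  refine ⟨e.toLinearMap ∘ₗ U.mkQ, ?_⟩
  simpa using hwU

end Radical

section Free

variable {A : Type u} [Ring A]

theorem mem_smul_top_pi_iff {n : ℕ} (I : Ideal A) [I.IsTwoSided] {x : Fin n → A} :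
    x ∈ (I • ⊤ : Submodule A (Fin n → A)) ↔ ∀ i, x i ∈ I := by
  constructor
  · intro hx i
    have h : (I • ⊤ : Submodule A (Fin n → A)) ≤ Submodule.comap (LinearMap.proj i) I :=
      Submodule.smul_le.2 fun a ha y _ => I.mul_mem_right (y i) ha
    exact h hx
  · intro hx
    rw [pi_eq_sum_univ' x]
    exact Submodule.sum_mem _ fun i _ => Submodule.smul_mem_smul (hx i) trivial

theorem exists_equiv_pi_of_projective [IsLocalRing A] [IsNoetherianRing A]
    (P : Type*) [AddCommGroup P] [Module A P] [Module.Projective A P] [Module.Finite A P] :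
    ∃ t : ℕ, Nonempty (P ≃ₗ[A] (Fin t → A)) := by
  classical
  have hex : ∃ n : ℕ, ∃ f : (Fin n → A) →ₗ[A] P, Function.Surjective f :=
    Module.Finite.exists_fin' A P
  obtain ⟨f, hf⟩ := Nat.find_spec hex
  have hlt : ∀ m < Nat.find hex, ¬ ∃ f : (Fin m → A) →ₗ[A] P, Function.Surjective f :=
    fun m hm => Nat.find_min hex hm
  generalize Nat.find hex = n at f hf hlt
  have hker : ker f ≤ Ring.jacobson A • (⊤ : Submodule A (Fin n → A)) := by
    intro x hx
    rw [mem_smul_top_pi_iff]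
    intro i
    by_contra hi
    obtain ⟨v, hv⟩ := (isUnit_of_notMem_jacobson hi).exists_left_inv
    obtain _ | m := n
    · exact i.elim0
    refine hlt m (Nat.lt_succ_self m)
      ⟨f ∘ₗ Function.ExtendByZero.linearMap A i.succAbove, fun p => ?_⟩
    obtain ⟨y, rfl⟩ := hf p
    let z := y - (y i * v) • x
    have hzi : z i = 0 := by simp [z, mul_assoc, hv]
    refine ⟨z ∘ i.succAbove, ?_⟩
    have : Function.ExtendByZero.linearMap A i.succAbove (z ∘ i.succAbove) = z := by
      ext j
      rcases Fin.eq_self_or_eq_succAbove i j with rfl | ⟨j, rfl⟩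
      · simp [hzi]
      · simp [Fin.succAbove_right_injective.extend_apply]
    rw [LinearMap.comp_apply, this]
    simp [z, LinearMap.mem_ker.1 hx]
  obtain ⟨s, hs⟩ := Module.projective_lifting_property f LinearMap.id hf
  have hs' : ∀ p, f (s p) = p := fun p => LinearMap.congr_fun hs p
  let π : (Fin n → A) →ₗ[A] (Fin n → A) := LinearMap.id - s ∘ₗ f
  have hπ : ∀ x, π x ∈ ker f := fun x => by simp [π, hs']
  have hfix : ∀ x ∈ ker f, π x = x := fun x hx => by simp [π, LinearMap.mem_ker.1 hx]
  have hbot : ker f = ⊥ := by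
    refine Submodule.FG.eq_bot_of_le_jacobson_smul (IsNoetherian.noetherian _) ?_
    intro x hx
    rw [← hfix x hx]
    have h1 : π x ∈ (Ring.jacobson A • (⊤ : Submodule A (Fin n → A))).map π :=
      Submodule.mem_map_of_mem (hker hx)
    rw [Submodule.map_smul''] at h1
    refine Submodule.smul_mono le_rfl ?_ h1
    rintro _ ⟨y, -, rfl⟩
    exact hπ y
  exact ⟨n, ⟨(LinearEquiv.ofBijective f ⟨LinearMap.ker_eq_bot.1 hbot, hf⟩).symm⟩⟩

end Free

section Length

variable {A : Type u} [Ring A]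

theorem length_eq_add_quotient {M : Type*} [AddCommGroup M] [Module A M] (N : Submodule A M) :
    Module.length A M = Module.length A N + Module.length A (M ⧸ N) :=
  Module.length_eq_add_of_exact N.subtype N.mkQ N.injective_subtype N.mkQ_surjective
    (LinearMap.exact_subtype_mkQ N)

theorem length_eq_add_range {M N : Type*} [AddCommGroup M] [Module A M] [AddCommGroup N]
    [Module A N] (f : M →ₗ[A] N) :
    Module.length A M = Module.length A (ker f) + Module.length A (range f) := by
  rw [length_eq_add_quotient (ker f), f.quotKerEquivRange.length_eq]

theorem map_smul_top_of_surjective {M N : Type*} [AddCommGroup M] [Module A M] [AddCommGroup N]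
    [Module A N] (I : Ideal A) (f : M →ₗ[A] N) (hf : Function.Surjective f) :
    (I • ⊤ : Submodule A M).map f = I • ⊤ := by
  rw [Submodule.map_smul'', Submodule.map_top, LinearMap.range_eq_top.2 hf]

theorem length_smul_top_of_equiv_pi {M : Type*} [AddCommGroup M] [Module A M] {t : ℕ}
    (φ : M ≃ₗ[A] (Fin t → A)) (I : Ideal A) [I.IsTwoSided] :
    Module.length A (I • ⊤ : Submodule A M) = t * Module.length A I := by
  have h : (I • ⊤ : Submodule A M).map φ.toLinearMap = I • ⊤ :=
    map_smul_top_of_surjective I φ.toLinearMap φ.surjective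
  let ψ : (Fin t → I) →ₗ[A] (Fin t → A) := LinearMap.compLeft I.subtype (Fin t)
  have hψ : Function.Injective ψ := fun x y hxy => by
    ext i
    exact congrFun hxy i
  have hr : range ψ = I • ⊤ := by
    ext x
    rw [mem_smul_top_pi_iff]
    constructor
    · rintro ⟨y, rfl⟩ i
      exact (y i).2
    · exact fun hx => ⟨fun i => ⟨x i, hx i⟩, rfl⟩
  rw [(φ.submoduleMap _).length_eq, h, ← hr, ← (LinearEquiv.ofInjective ψ hψ).length_eq,
    Module.length_pi_of_fintype]
  simp

theorem length_of_equiv_pi {M : Type*} [AddCommGroup M] [Module A M] {t : ℕ}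
    (φ : M ≃ₗ[A] (Fin t → A)) : Module.length A M = t * Module.length A A := by
  rw [φ.length_eq, Module.length_pi_of_fintype]
  simp

theorem length_quotient_smul_top_of_surjective [IsLocalRing A] [IsArtinianRing A]
    {M N : Type*} [AddCommGroup M] [Module A M] [AddCommGroup N] [Module A N] {t : ℕ}
    (φ : M ≃ₗ[A] (Fin t → A)) (f : M →ₗ[A] N) (hf : Function.Surjective f)
    (hker : ker f ≤ Ring.jacobson A • ⊤) :
    Module.length A (N ⧸ (Ring.jacobson A • ⊤ : Submodule A N)) = t := by
  let q : M →ₗ[A] N ⧸ (Ring.jacobson A • ⊤ : Submodule A N) := Submodule.mkQ _ ∘ₗ f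
  have hq : Function.Surjective q := (Submodule.mkQ_surjective _).comp hf
  have hkq : ker q = Ring.jacobson A • ⊤ := by
    rw [LinearMap.ker_comp, Submodule.ker_mkQ, ← map_smul_top_of_surjective _ f hf,
      Submodule.comap_map_eq, sup_eq_left]
    exact hker
  have : Module.Finite A M := .equiv φ.symm
  have hfin : Module.length A (Ring.jacobson A • ⊤ : Submodule A M) ≠ ⊤ := Module.length_ne_top
  have h1 := length_eq_add_quotient (Ring.jacobson A • ⊤ : Submodule A M)
  rw [length_of_equiv_pi φ, length_eq_add_quotient (Ring.jacobson A),
    Module.length_eq_one A (A ⧸ _), mul_add, ← length_smul_top_of_equiv_pi φ, mul_one] at h1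
  have h2 := (ENat.addLECancellable_of_ne_top hfin).inj.1 h1
  rw [h2, ← (LinearMap.quotKerEquivOfSurjective q hq).length_eq, hkq]

end Length

section Retract

variable {A : Type u} [Ring A] [IsLocalRing A] [IsArtinianRing A]

/-- The simple module over a local ring is a direct summand of `M`. -/
def HasSimpleRetract (A : Type u) [Ring A] (M : Type u) [AddCommGroup M] [Module A M] : Prop :=
  ∃ (s : (A ⧸ Ring.jacobson A) →ₗ[A] M) (r : M →ₗ[A] A ⧸ Ring.jacobson A), r ∘ₗ s = LinearMap.id

theorem hasSimpleRetract_of_notMem {M : Type u} [AddCommGroup M] [Module A M] {w : M}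
    (hw : w ∉ (Ring.jacobson A • ⊤ : Submodule A M)) (hJ : ∀ a ∈ Ring.jacobson A, a • w = 0) :
    HasSimpleRetract A M := by
  obtain ⟨r, hr⟩ := exists_linearMap_quotient_jacobson_ne_zero hw
  let s : (A ⧸ Ring.jacobson A) →ₗ[A] M :=
    Submodule.liftQ _ (LinearMap.toSpanSingleton A M w) fun a ha => by simpa using hJ a ha
  have hs : s (Submodule.Quotient.mk 1) = w :=
    (Submodule.liftQ_apply _ _ _).trans (one_smul A w)
  have hne : r ∘ₗ s ≠ 0 := fun h => hr (by
    rw [← hs]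
    exact LinearMap.congr_fun h _)
  let ε := LinearEquiv.ofBijective (r ∘ₗ s) (LinearMap.bijective_of_ne_zero hne)
  refine ⟨s, ε.symm.toLinearMap ∘ₗ r, ?_⟩
  exact LinearMap.ext fun x => ε.symm_apply_apply x

end Retract

section FormExtension

variable {A : Type u} [Ring A] {P : ℕ → Type u} [∀ n, AddCommGroup (P n)] [∀ n, Module A (P n)]
  {M : Type u} [AddCommGroup M] [Module A M]

noncomputable def chainComplexOfMaps (f : ∀ n, P (n + 1) →ₗ[A] P n)
    (hf : ∀ n, range (f (n + 1)) = ker (f n)) : ChainComplex (ModuleCat.{u} A) ℕ :=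
  ChainComplex.of (fun n => ModuleCat.of A (P n)) (fun n => ModuleCat.ofHom (f n)) fun n => by
    rw [← ModuleCat.ofHom_comp, LinearMap.range_le_ker_iff.1 (hf n).le]; rfl

theorem chainComplexOfMaps_d (f : ∀ n, P (n + 1) →ₗ[A] P n)
    (hf : ∀ n, range (f (n + 1)) = ker (f n)) (n : ℕ) :
    (chainComplexOfMaps f hf).d (n + 1) n = ModuleCat.ofHom (f n) :=
  ChainComplex.of_d (X := fun n => ModuleCat.of A (P n)) (d := fun n => ModuleCat.ofHom (f n)) n

noncomputable def projectiveResolutionOfMaps [∀ n, Module.Projective A (P n)]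
    (f : ∀ n, P (n + 1) →ₗ[A] P n) (hf : ∀ n, range (f (n + 1)) = ker (f n))
    (p : P 0 →ₗ[A] M) (hp : Function.Surjective p) (hfp : range (f 0) = ker p) :
    ProjectiveResolution (ModuleCat.of A M) where
  complex := chainComplexOfMaps f hf
  projective n := by
    change Projective (ModuleCat.of A (P n))
    infer_instance
  π := (ChainComplex.toSingle₀Equiv _ _).symm ⟨ModuleCat.ofHom p, by
    have : (chainComplexOfMaps f hf).d 1 0 = ModuleCat.ofHom (f 0) :=
          chainComplexOfMaps_d f hf _
    rw [this]
    ext x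
    exact LinearMap.congr_fun (LinearMap.range_le_ker_iff.1 hfp.le) x⟩
  quasiIso := ⟨fun m => by
    cases m with
    | zero =>
      rw [ChainComplex.quasiIsoAt₀_iff, ShortComplex.quasiIso_iff_of_zeros' _ rfl rfl rfl]
      constructor
      · rw [ShortComplex.moduleCat_exact_iff_range_eq_ker]
        have : (chainComplexOfMaps f hf).d 1 0 = ModuleCat.ofHom (f 0) :=
          chainComplexOfMaps_d f hf _
        simpa [this, ChainComplex.toSingle₀Equiv] using! hfp
      · rw [ModuleCat.epi_iff_surjective]
        simpa [ChainComplex.toSingle₀Equiv] using! hp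
    | succ m =>
      rw [quasiIsoAt_iff_exactAt' (hL := ChainComplex.exactAt_succ_single_obj ..),
          HomologicalComplex.exactAt_iff' _ (m + 2) (m + 1) m (by simp) (by simp),
          ShortComplex.moduleCat_exact_iff_range_eq_ker]
      have h1 : (chainComplexOfMaps f hf).d (m + 2) (m + 1) = ModuleCat.ofHom (f (m + 1)) :=
        chainComplexOfMaps_d f hf _
      have h2 : (chainComplexOfMaps f hf).d (m + 1) m = ModuleCat.ofHom (f m) :=
        chainComplexOfMaps_d f hf _
      simpa [h1, h2] using! hf m⟩

theorem exists_comp_eq_of_extZero [∀ n, Module.Projective A (P n)]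
    (f : ∀ n, P (n + 1) →ₗ[A] P n) (hf : ∀ n, range (f (n + 1)) = ker (f n))
    (p : P 0 →ₗ[A] M) (hp : Function.Surjective p) (hfp : range (f 0) = ker p)
    {Y : Type u} [AddCommGroup Y] [Module A Y] {n : ℕ} (hext : extZero A M Y (n + 1))
    (h : P (n + 1) →ₗ[A] Y) (hh : h ∘ₗ f (n + 1) = 0) :
    ∃ h' : P n →ₗ[A] Y, h' ∘ₗ f n = h := by
  let R := projectiveResolutionOfMaps f hf p hp hfp
  have hz := hext.of_iso (R.isoExt (R := ℤ) (n + 1) (ModuleCat.of A Y)).symm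
  rw [← HomologicalComplex.exactAt_iff_isZero_homology,
    HomologicalComplex.exactAt_iff' _ n (n + 1) (n + 2) (by simp) (by simp),
    ShortComplex.moduleCat_exact_iff] at hz
  have h1 : R.complex.d (n + 2) (n + 1) = ModuleCat.ofHom (f (n + 1)) :=
    chainComplexOfMaps_d f hf _
  have h2 : R.complex.d (n + 1) n = ModuleCat.ofHom (f n) :=
    chainComplexOfMaps_d f hf _
  obtain ⟨h', hh'⟩ := hz (ModuleCat.ofHom h : ModuleCat.of A (P (n + 1)) ⟶ ModuleCat.of A Y) (by
    change R.complex.d (n + 2) (n + 1) ≫ ModuleCat.ofHom h = 0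
    rw [h1]
    exact congrArg ModuleCat.ofHom hh)
  refine ⟨ModuleCat.Hom.hom (show ModuleCat.of A (P n) ⟶ ModuleCat.of A Y from h'), ?_⟩
  change R.complex.d (n + 1) n ≫ h' = ModuleCat.ofHom h at hh'
  rw [h2] at hh'
  exact congrArg ModuleCat.Hom.hom hh'

variable {Q : ℤ → Type u} [∀ i, AddCommGroup (Q i)] [∀ i, Module A (Q i)]

/-- The differential `g i`, with its codomain `Q (i - 1)` rewritten as `Q j`. -/
def differentialTo (g : ∀ i : ℤ, Q i →ₗ[A] Q (i - 1)) {i j : ℤ} (h : j = i - 1) : Q i →ₗ[A] Q j :=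
  h ▸ g i

theorem range_differentialTo_eq_ker (g : ∀ i : ℤ, Q i →ₗ[A] Q (i - 1))
    (hg : ∀ i, range (g i) = ker (g (i - 1))) {i j l : ℤ} (h : j = i - 1) (h' : l = j - 1) :
    range (differentialTo g h) = ker (differentialTo g h') := by
  subst h; subst h'; exact hg i

theorem range_differentialTo (g : ∀ i : ℤ, Q i →ₗ[A] Q (i - 1)) {i j : ℤ} (h : i = j) :
    range (differentialTo g (show j - 1 = i - 1 by rw [h])) = range (g j) := by
  subst h; rfl

/-- Every linear form on the image of `g i` extends to `Q (i - 1)`. -/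
def FormsExtend (g : ∀ i : ℤ, Q i →ₗ[A] Q (i - 1)) (i : ℤ) : Prop :=
  ∀ h : range (g i) →ₗ[A] A, ∃ h' : Q (i - 1) →ₗ[A] A, ∀ x : range (g i), h' x = h x

theorem formsExtend_of_sGp (g : ∀ i : ℤ, Q i →ₗ[A] Q (i - 1))
    (hg : ∀ i, range (g i) = ker (g (i - 1))) [∀ i, Module.Projective A (Q i)] {i₀ i : ℤ}
    (hs : sGp A (range (g i₀))) (hi : i₀ < i) : FormsExtend g i := by
  obtain ⟨n, rfl⟩ : ∃ n : ℕ, i = i₀ + (n + 1 : ℕ) := by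
    obtain ⟨n, hn⟩ := Int.eq_ofNat_of_zero_le (show 0 ≤ i - i₀ - 1 by omega)
    exact ⟨n, by push_cast; omega⟩
  intro h
  have hr := range_differentialTo g (show i₀ + (0 : ℕ) = i₀ by simp)
  have hk (n : ℕ) : i₀ + (n : ℕ) = i₀ + (n + 1 : ℕ) - 1 := by push_cast; ring
  let f (n : ℕ) : Q (i₀ + (n + 1 : ℕ)) →ₗ[A] Q (i₀ + (n : ℕ)) := differentialTo g (hk n)
  let p : Q (i₀ + (0 : ℕ)) →ₗ[A] range (g i₀) :=
    (differentialTo g (show i₀ - 1 = i₀ + (0 : ℕ) - 1 by simp)).codRestrict _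
      fun x => hr ▸ LinearMap.mem_range_self _ x
  obtain ⟨h', hh'⟩ := exists_comp_eq_of_extZero (P := fun n : ℕ => Q (i₀ + n)) f
    (fun n => range_differentialTo_eq_ker g hg _ _) p
    (by
      rw [← LinearMap.range_eq_top, LinearMap.range_codRestrict, hr, Submodule.comap_subtype_self])
    (by
      rw [LinearMap.ker_codRestrict]
      exact range_differentialTo_eq_ker g hg _ _)
    (hs (n + 1) (by omega)) (h ∘ₗ (g (i₀ + (n + 1 : ℕ))).rangeRestrict) (by
      ext x
      have : g (i₀ + (n + 1 : ℕ)) (f (n + 1) x) = 0 :=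
        LinearMap.congr_fun (LinearMap.range_le_ker_iff.1
            (range_differentialTo_eq_ker g hg (hk (n + 1)) rfl).le) x
      have h0 : (g (i₀ + (n + 1 : ℕ))).rangeRestrict (f (n + 1) x) = 0 := Subtype.ext this
      exact (congrArg h h0).trans (map_zero h))
  have key : ∀ {j : ℤ} (hj : j = i₀ + (n + 1 : ℕ) - 1) (h' : Q j →ₗ[A] A),
      h' ∘ₗ differentialTo g hj = h ∘ₗ (g (i₀ + (n + 1 : ℕ))).rangeRestrict →
      ∃ h' : Q (i₀ + (n + 1 : ℕ) - 1) →ₗ[A] A, ∀ x : range (g (i₀ + (n + 1 : ℕ))), h' x = h x := by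
    rintro j rfl h' hh
    refine ⟨h', ?_⟩
    rintro ⟨_, y, rfl⟩
    exact LinearMap.congr_fun hh y
  exact key (hk n) h' hh'

end FormExtension

section ExtRegular

variable {A : Type u} [Ring A] {K P M : Type u} [AddCommGroup K] [Module A K] [AddCommGroup P]
  [Module A P] [AddCommGroup M] [Module A M]

/-- Vanishing of `Ext^n_A(M, A)`, for the derived category model of `Ext`. -/
def ExtRegularVanishes (A M : Type u) [Ring A] [AddCommGroup M] [Module A M] (n : ℕ) : Prop :=
  ∀ x : Abelian.Ext (ModuleCat.of A M) (ModuleCat.of A A) n, x = 0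

theorem shortExact_moduleCat {f : K →ₗ[A] P} {p : P →ₗ[A] M} (hf : Function.Injective f)
    (hp : Function.Surjective p) (h : range f = ker p) :
    (ShortComplex.moduleCatMkOfKerLERange (ModuleCat.ofHom f) (ModuleCat.ofHom p)
      (by simpa using h.le)).ShortExact where
  exact := ShortComplex.Exact.moduleCat_of_range_eq_ker _ _ (by simpa using h)
  mono_f := (ModuleCat.mono_iff_injective _).2 hf
  epi_g := (ModuleCat.epi_iff_surjective _).2 hp

theorem ExtRegularVanishes.succ_of_projective [Module.Projective A P] {f : K →ₗ[A] P}
    {p : P →ₗ[A] M} (hf : Function.Injective f) (hp : Function.Surjective p)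
    (h : range f = ker p) {n : ℕ} (hn : ExtRegularVanishes A K n) :
    ExtRegularVanishes A M (n + 1) := by
  have hS := shortExact_moduleCat hf hp h
  have : Projective (ModuleCat.of A P) := inferInstance
  intro x
  obtain ⟨y, rfl⟩ := Abelian.Ext.contravariant_sequence_exact₃ hS (ModuleCat.of A A) x
    (Abelian.Ext.eq_zero_of_projective (P := ModuleCat.of A P) _) (add_comm 1 n)
  have hy : y = 0 := hn y
  rw [hy, Abelian.Ext.comp_zero]
  rfl

theorem ExtRegularVanishes.of_succ {f : K →ₗ[A] P}
    {p : P →ₗ[A] M} (hf : Function.Injective f) (hp : Function.Surjective p)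
    (h : range f = ker p) {n : ℕ} (hP : ExtRegularVanishes A P n)
    (hn : ExtRegularVanishes A M (n + 1)) :
    ExtRegularVanishes A K n := by
  have hS := shortExact_moduleCat hf hp h
  intro x
  obtain ⟨y, rfl⟩ := Abelian.Ext.contravariant_sequence_exact₁ hS (ModuleCat.of A A) x
    (add_comm 1 n) (hn _)
  have hy : y = 0 := hP y
  rw [hy, Abelian.Ext.comp_zero]
  rfl

theorem ExtRegularVanishes.of_ends {f : K →ₗ[A] P}
    {p : P →ₗ[A] M} (hf : Function.Injective f) (hp : Function.Surjective p)
    (h : range f = ker p) {n : ℕ} (hK : ExtRegularVanishes A K n)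
    (hM : ExtRegularVanishes A M n) :
    ExtRegularVanishes A P n := by
  have hS := shortExact_moduleCat hf hp h
  intro x
  obtain ⟨y, rfl⟩ := Abelian.Ext.contravariant_sequence_exact₂ hS (ModuleCat.of A A) x (hK _)
  have hy : y = 0 := hM y
  rw [hy, Abelian.Ext.comp_zero]
  rfl

theorem extRegularVanishes_of_projective [Module.Projective A P] (n : ℕ) :
    ExtRegularVanishes A P (n + 1) := fun x => by
  have : Projective (ModuleCat.of A P) := inferInstance
  exact Abelian.Ext.eq_zero_of_projective x

theorem ExtRegularVanishes.of_retract {s : K →ₗ[A] M} {r : M →ₗ[A] K} (h : r ∘ₗ s = LinearMap.id)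
    {n : ℕ} (hM : ExtRegularVanishes A M n) : ExtRegularVanishes A K n := fun x => by
  have : (Abelian.Ext.mk₀ (ModuleCat.ofHom s)).comp
      ((Abelian.Ext.mk₀ (ModuleCat.ofHom r)).comp x (zero_add n)) (zero_add n) = x := by
    rw [Abelian.Ext.mk₀_comp_mk₀_assoc, ← ModuleCat.ofHom_comp, h]
    exact Abelian.Ext.mk₀_id_comp x
  have h0 : (Abelian.Ext.mk₀ (ModuleCat.ofHom r)).comp x (zero_add n) = 0 := hM _
  rw [← this, h0, Abelian.Ext.comp_zero]

theorem ExtRegularVanishes.of_equiv (e : K ≃ₗ[A] M) {n : ℕ} (hM : ExtRegularVanishes A M n) :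
    ExtRegularVanishes A K n :=
  hM.of_retract (s := e.toLinearMap) (r := e.symm.toLinearMap) (by ext; simp)

theorem ExtRegularVanishes.exists_extension {f : K →ₗ[A] P} {p : P →ₗ[A] M}
    (hf : Function.Injective f) (hp : Function.Surjective p)
    (h : range f = ker p) (hM : ExtRegularVanishes A M 1) (φ : K →ₗ[A] A) :
    ∃ ψ : P →ₗ[A] A, ψ ∘ₗ f = φ := by
  have hS := shortExact_moduleCat hf hp h
  obtain ⟨y, hy⟩ := Abelian.Ext.contravariant_sequence_exact₁ hS (ModuleCat.of A A)
    (Abelian.Ext.mk₀ (ModuleCat.ofHom φ)) (add_zero 1) (hM _)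
  obtain ⟨ψ, rfl⟩ := Abelian.Ext.addEquiv₀.symm.surjective y
  refine ⟨ModuleCat.Hom.hom (show ModuleCat.of A P ⟶ ModuleCat.of A A from ψ), ?_⟩
  have hy' : (Abelian.Ext.mk₀ (ModuleCat.ofHom f)).comp (Abelian.Ext.mk₀
    (show ModuleCat.of A P ⟶ ModuleCat.of A A from ψ)) (zero_add 0) =
    Abelian.Ext.mk₀ (ModuleCat.ofHom φ) := hy
  rw [Abelian.Ext.mk₀_comp_mk₀] at hy'
  exact congrArg ModuleCat.Hom.hom (Abelian.Ext.homEquiv₀.symm.injective hy')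

theorem extRegularVanishes_one_of_forall_extension [Module.Projective A P] {f : K →ₗ[A] P}
    {p : P →ₗ[A] M} (hf : Function.Injective f) (hp : Function.Surjective p)
    (h : range f = ker p) (hext : ∀ φ : K →ₗ[A] A, ∃ ψ : P →ₗ[A] A, ψ ∘ₗ f = φ) :
    ExtRegularVanishes A M 1 := by
  have hS := shortExact_moduleCat hf hp h
  have : Projective (ModuleCat.of A P) := inferInstance
  intro x
  obtain ⟨y, rfl⟩ := Abelian.Ext.contravariant_sequence_exact₃ hS (ModuleCat.of A A) x
    (Abelian.Ext.eq_zero_of_projective (P := ModuleCat.of A P) _) (add_zero 1)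
  obtain ⟨φ, rfl⟩ := Abelian.Ext.homEquiv₀.symm.surjective y
  obtain ⟨ψ, hψ⟩ := hext (ModuleCat.Hom.hom (show ModuleCat.of A K ⟶ ModuleCat.of A A from φ))
  have hφ : (show ModuleCat.of A K ⟶ ModuleCat.of A A from φ) =
      ModuleCat.ofHom f ≫ ModuleCat.ofHom ψ := by
    ext x
    exact (LinearMap.congr_fun hψ x).symm
  have : Abelian.Ext.homEquiv₀.symm φ = (Abelian.Ext.mk₀ (ModuleCat.ofHom f)).comp
      (Abelian.Ext.mk₀ (ModuleCat.ofHom ψ)) (zero_add 0) := by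
    rw [Abelian.Ext.mk₀_comp_mk₀]
    exact congrArg Abelian.Ext.homEquiv₀.symm hφ
  rw [this]
  exact hS.extClass_comp_assoc _
end ExtRegular

section SimpleRetract

variable {A : Type u} [Ring A] [IsLocalRing A]

theorem extRegularVanishes_of_isFiniteLength {n : ℕ}
    (hS : ExtRegularVanishes A (A ⧸ Ring.jacobson A) (n + 1)) {M : Type u} [AddCommGroup M]
    [Module A M] (hM : IsFiniteLength A M) : ExtRegularVanishes A M (n + 1) := by
  induction hM with
  | of_subsingleton =>
    rename_i M _ _ _
    exact (extRegularVanishes_of_projective (A := A) (P := PUnit.{u + 1}) n).of_equiv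
      (LinearEquiv.ofSubsingleton M PUnit.{u + 1})
  | @of_simple_quotient M _ _ N _ _ ih =>
    obtain ⟨φ⟩ := nonempty_equiv_quotient_jacobson (A := A) (M ⧸ N)
    exact .of_ends (f := N.subtype) (p := N.mkQ) N.injective_subtype N.mkQ_surjective
      (by simp) ih (hS.of_equiv φ)

theorem injective_of_extRegularVanishes [IsArtinianRing A] {n : ℕ}
    (hS : ExtRegularVanishes A (A ⧸ Ring.jacobson A) (n + 1)) : Module.Injective A A := by
  obtain ⟨I, hI⟩ := IsAtomic.exists_atom (Ideal A)
  have : IsSimpleModule A I := isSimpleModule_iff_isAtom.2 hI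
  obtain ⟨φ⟩ := nonempty_equiv_quotient_jacobson (A := A) I
  have hfl (K : Ideal A) : IsFiniteLength A (A ⧸ K) :=
    isFiniteLength_iff_isNoetherian_isArtinian.2 ⟨inferInstance, inferInstance⟩
  have h1 : ExtRegularVanishes A (A ⧸ Ring.jacobson A) 1 := by
    induction n with
    | zero => exact hS
    | succ n ih =>
      refine ih (.of_equiv φ.symm (.of_succ (f := I.subtype) (p := I.mkQ) I.injective_subtype
        I.mkQ_surjective (by simp) (extRegularVanishes_of_projective n) ?_))
      exact extRegularVanishes_of_isFiniteLength hS (hfl I)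
  refine Module.Baer.injective fun K φ => ?_
  obtain ⟨ψ, hψ⟩ := (extRegularVanishes_of_isFiniteLength h1 (hfl K)).exists_extension
    (f := K.subtype) (p := K.mkQ) K.injective_subtype K.mkQ_surjective (by simp) φ
  exact ⟨ψ, fun x hx => LinearMap.congr_fun hψ ⟨x, hx⟩⟩

variable {Q : ℤ → Type u} [∀ i, AddCommGroup (Q i)] [∀ i, Module A (Q i)]

theorem not_hasSimpleRetract_range [IsArtinianRing A] [∀ i, Module.Projective A (Q i)]
    (hA : ¬ Module.Injective A A) (g : ∀ i : ℤ, Q i →ₗ[A] Q (i - 1))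
    (hg : ∀ i, range (g i) = ker (g (i - 1))) {i₀ : ℤ} (hs : sGp A (range (g i₀))) (i : ℤ) :
    ¬ HasSimpleRetract A (range (g i)) := by
  have key : ∀ (n : ℕ) (j : ℤ), i₀ ≤ j + n → ExtRegularVanishes A (range (g j)) (n + 1) := by
    intro n
    induction n with
    | zero =>
      intro j hj
      obtain ⟨i, rfl⟩ : ∃ i, j = i - 1 := ⟨j + 1, by ring⟩
      refine extRegularVanishes_one_of_forall_extension (f := (range (g i)).subtype)
        (p := (g (i - 1)).rangeRestrict) (Submodule.injective_subtype _)
        (LinearMap.surjective_rangeRestrict _) (by simp [hg]) fun φ => ?_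
      obtain ⟨ψ, hψ⟩ := formsExtend_of_sGp g hg hs (i := i) (by push_cast at hj; omega) φ
      exact ⟨ψ, LinearMap.ext hψ⟩
    | succ n ih =>
      intro j hj
      obtain ⟨i, rfl⟩ : ∃ i, j = i - 1 := ⟨j + 1, by ring⟩
      exact .succ_of_projective (f := (range (g i)).subtype)
        (p := (g (i - 1)).rangeRestrict) (Submodule.injective_subtype _)
        (LinearMap.surjective_rangeRestrict _) (by simp [hg]) (ih i (by push_cast at hj; omega))
  rintro ⟨s, r, hrs⟩
  exact hA (injective_of_extRegularVanishes
    ((key (i₀ - i).toNat i (by have := Int.self_le_toNat (i₀ - i); omega)).of_retract hrs))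

end SimpleRetract

section ShortRing

variable {A : Type u} [Ring A] {P : Type u} [AddCommGroup P] [Module A P] {N : Submodule A P}

theorem forall_mem_sq_of_forall_mem_jacobson (hN : N ≤ Ring.jacobson A • ⊤)
    {φ : P →ₗ[A] A} (hφ : ∀ x, φ x ∈ Ring.jacobson A) {x : P} (hx : x ∈ N) :
    φ x ∈ Ring.jacobson A * Ring.jacobson A := by
  have hmap := Submodule.mem_map_of_mem (f := φ) (hN hx)
  rw [Submodule.map_smul''] at hmap
  refine Submodule.smul_mono le_rfl ?_ hmap
  rintro _ ⟨z, -, rfl⟩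
  exact hφ z

variable [IsLocalRing A]

theorem forall_mem_jacobson_of_forall_mem_sq
    (hJ : Ring.jacobson A * (Ring.jacobson A * Ring.jacobson A) = ⊥)
    (hJJ : Ring.jacobson A * Ring.jacobson A ≠ ⊥)
    (hN : (Ring.jacobson A * Ring.jacobson A) • (⊤ : Submodule A P) = Ring.jacobson A • N)
    {φ : P →ₗ[A] A} (hφ : ∀ x ∈ N, φ x ∈ Ring.jacobson A * Ring.jacobson A) (x : P) :
    φ x ∈ Ring.jacobson A := by
  by_contra hx
  obtain ⟨u, hu⟩ := isUnit_of_notMem_jacobson hx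
  refine hJJ ((Submodule.eq_bot_iff _).2 fun y hy => ?_)
  have hyx : (y * ↑u⁻¹) • x ∈ Ring.jacobson A • N :=
    hN ▸ Submodule.smul_mem_smul (Ideal.mul_mem_right _ _ hy) trivial
  have hmap := Submodule.mem_map_of_mem (f := φ) hyx
  rw [Submodule.map_smul''] at hmap
  have hle : N.map φ ≤ Ring.jacobson A * Ring.jacobson A := by
    rintro _ ⟨z, hz, rfl⟩
    exact hφ z hz
  have := Submodule.smul_mono (le_refl (Ring.jacobson A)) hle hmap
  rw [smul_eq_mul, hJ, Submodule.mem_bot, map_smul, ← hu, smul_eq_mul, mul_assoc,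
    Units.inv_mul, mul_one] at this
  exact this

variable [IsArtinianRing A]

theorem jacobson_sq_smul_top_eq (hJ : Ring.jacobson A * (Ring.jacobson A * Ring.jacobson A) = ⊥)
    (hN : N ≤ Ring.jacobson A • ⊤)
    (hN' : (Ring.jacobson A * Ring.jacobson A) • (⊤ : Submodule A P) ≤ N)
    (hr : ¬ HasSimpleRetract A N) :
    (Ring.jacobson A * Ring.jacobson A) • (⊤ : Submodule A P) = Ring.jacobson A • N := by
  refine le_antisymm (fun w hw => ?_) ?_
  · by_contra hwN
    refine hr (hasSimpleRetract_of_notMem (w := ⟨w, hN' hw⟩) ?_ fun a ha => ?_)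
    · rwa [Submodule.mem_smul_top_iff]
    · have : a • w ∈ Ring.jacobson A • (Ring.jacobson A * Ring.jacobson A) • (⊤ : Submodule A P) :=
        Submodule.smul_mem_smul ha hw
      rw [← Submodule.mul_smul, hJ, Submodule.bot_smul, Submodule.mem_bot] at this
      exact Subtype.ext this
  · rw [Submodule.mul_smul]
    exact Submodule.smul_mono le_rfl hN

theorem mem_jacobson_sq_of_annihilated
    (hJ : Ring.jacobson A * (Ring.jacobson A * Ring.jacobson A) = ⊥)
    (hJJ : Ring.jacobson A * Ring.jacobson A ≠ ⊥)
    (hN : N ≤ Ring.jacobson A • ⊤)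
    (hN' : (Ring.jacobson A * Ring.jacobson A) • (⊤ : Submodule A P) ≤ N) (hne : N ≠ ⊥)
    (hext : ∀ f : N →ₗ[A] A, ∃ φ : P →ₗ[A] A, ∀ x : N, φ x = f x) {x : A}
    (hx : ∀ a ∈ Ring.jacobson A, a * x = 0) : x ∈ Ring.jacobson A * Ring.jacobson A := by
  obtain ⟨w, hw⟩ : ∃ w : N, w ∉ (Ring.jacobson A • ⊤ : Submodule A N) := by
    by_contra! h
    have h1 : (Ring.jacobson A • ⊤ : Submodule A N) = ⊤ := eq_top_iff.2 fun w _ => h w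
    have h2 : (⊤ : Submodule A N) = ⊥ := by
      rw [← Submodule.bot_smul (R := A) (A := A) (⊤ : Submodule A N), ← hJ, Submodule.mul_smul,
        Submodule.mul_smul, h1, h1, h1]
    refine hne ((Submodule.eq_bot_iff _).2 fun y hy => ?_)
    have : (⟨y, hy⟩ : N) ∈ (⊥ : Submodule A N) := h2 ▸ Submodule.mem_top
    exact congrArg Subtype.val ((Submodule.mem_bot A).1 this)
  obtain ⟨r, hr⟩ := exists_linearMap_quotient_jacobson_ne_zero hw
  have hr_surj : Function.Surjective r :=
    LinearMap.surjective_of_ne_zero fun h => hr (by simp [h])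
  obtain ⟨w', hw'⟩ := hr_surj (Submodule.Quotient.mk 1)
  let c : (A ⧸ Ring.jacobson A) →ₗ[A] A :=
    Submodule.liftQ _ (LinearMap.toSpanSingleton A A x) fun a ha => by simpa using hx a ha
  have hc (b : A) : c (Submodule.Quotient.mk b) = b * x := Submodule.liftQ_apply _ _ _
  obtain ⟨φ, hφ⟩ := hext (c ∘ₗ r)
  have hxw : φ w' = x := by rw [hφ, LinearMap.comp_apply, hw', hc, one_mul]
  by_cases h : ∀ q, φ q ∈ Ring.jacobson A
  · rw [← hxw]
    exact forall_mem_sq_of_forall_mem_jacobson hN h w'.2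
  · push Not at h
    obtain ⟨q, hq⟩ := h
    obtain ⟨u, hu⟩ := isUnit_of_notMem_jacobson hq
    obtain ⟨y, hy, hy0⟩ := Submodule.exists_mem_ne_zero_of_ne_bot hJJ
    have hyq : (y * ↑u⁻¹) • q ∈ N :=
      hN' (Submodule.smul_mem_smul (Ideal.mul_mem_right _ _ hy) trivial)
    obtain ⟨b, hb⟩ := Submodule.Quotient.mk_surjective _ (r ⟨_, hyq⟩)
    have hyb : y = b * x := by
      have := hφ ⟨_, hyq⟩
      rw [LinearMap.comp_apply, ← hb, hc] at this
      rw [← this, map_smul, ← hu, smul_eq_mul, mul_assoc, Units.inv_mul, mul_one]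
    have hbJ : b ∉ Ring.jacobson A := fun hbJ => hy0 (hyb.trans (hx b hbJ))
    obtain ⟨v, rfl⟩ := isUnit_of_notMem_jacobson hbJ
    have : x = ↑v⁻¹ * y := by rw [hyb, ← mul_assoc, Units.inv_mul, one_mul]
    rw [this]
    exact Ideal.mul_mem_left _ _ hy

end ShortRing

section DualLength

variable {A : Type u} [Ring A] {k : Type u} [CommRing k]
  {K P M : Type u} [AddCommGroup K] [Module A K] [AddCommGroup P]
  [Module A P] [AddCommGroup M] [Module A M]

theorem length_linearMap_of_equiv_pi [Module k M] [SMulCommClass A k M] {t : ℕ}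
    (φ : P ≃ₗ[A] (Fin t → A)) : Module.length k (P →ₗ[A] M) = t * Module.length k M := by
  rw [← ((Module.Basis.ofEquivFun φ).constr k (M' := M)).length_eq, Module.length_pi]
  simp

variable [Algebra k A]

/-- The `A`-linear forms on `M` with values in `I`. -/
def formsInto (k : Type u) [CommRing k] [Algebra k A] (I : Ideal A) (M : Type u) [AddCommGroup M]
    [Module A M] : Submodule k (M →ₗ[A] A) where
  carrier := {φ | ∀ x, φ x ∈ I}
  add_mem' hφ hψ x := I.add_mem (hφ x) (hψ x)
  zero_mem' _ := I.zero_mem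
  smul_mem' c φ hφ x := by
    rw [LinearMap.smul_apply, Algebra.smul_def]
    exact I.mul_mem_left _ (hφ x)

theorem length_formsInto_of_equiv_pi (I : Ideal A) {t : ℕ} (φ : P ≃ₗ[A] (Fin t → A)) :
    Module.length k (formsInto k I P) = t * Module.length k I := by
  let e : formsInto k I P ≃ₗ[k] (P →ₗ[A] I) :=
    { toFun ψ := ψ.1.codRestrict I ψ.2
      map_add' _ _ := rfl
      map_smul' _ _ := rfl
      invFun ψ := ⟨I.subtype ∘ₗ ψ, fun x => (ψ x).2⟩
      left_inv _ := rfl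
      right_inv _ := rfl }
  rw [e.length_eq, length_linearMap_of_equiv_pi φ]

theorem lcomp_injective_of_surjective {p : P →ₗ[A] M} (hp : Function.Surjective p) :
    Function.Injective (lcomp k A p) := fun φ ψ h => by
  ext x
  obtain ⟨y, rfl⟩ := hp x
  exact LinearMap.congr_fun h y

theorem mem_range_lcomp_iff {p : P →ₗ[A] M} (hp : Function.Surjective p) {φ : P →ₗ[A] A} :
    φ ∈ range (lcomp k A p) ↔ ker p ≤ ker φ := by
  constructor
  · rintro ⟨ψ, rfl⟩ x hx
    rw [LinearMap.mem_ker] at hx ⊢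
    rw [lcomp_apply, hx, map_zero]
  · intro h
    refine ⟨(ker p).liftQ φ h ∘ₗ (p.quotKerEquivOfSurjective hp).symm.toLinearMap, ?_⟩
    ext x
    have : (p.quotKerEquivOfSurjective hp).symm (p x) = Submodule.Quotient.mk x := by
      rw [LinearEquiv.symm_apply_eq]
      rfl
    simp [this]

theorem length_formsInto_of_surjective {I : Ideal A} {p : P →ₗ[A] M} (hp : Function.Surjective p)
    (h : ∀ φ ∈ formsInto k I P, ker p ≤ ker φ) :
    Module.length k (formsInto k I M) = Module.length k (formsInto k I P) := by
  have : formsInto k I P = (formsInto k I M).map (lcomp k A p) := by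
    ext φ
    constructor
    · intro hφ
      obtain ⟨ψ, rfl⟩ := (mem_range_lcomp_iff (k := k) hp).2 (h φ hφ)
      refine ⟨ψ, fun x => ?_, rfl⟩
      obtain ⟨y, rfl⟩ := hp x
      exact hφ y
    · rintro ⟨ψ, hψ, rfl⟩ x
      exact hψ (p x)
  rw [this]
  exact (Submodule.equivMapOfInjective _ (lcomp_injective_of_surjective (k := k) hp) _).length_eq

theorem length_linearMap_eq_add {f : K →ₗ[A] P} {p : P →ₗ[A] M} (hp : Function.Surjective p)
    (h : range f = ker p) :
    Module.length k (P →ₗ[A] A) =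
      Module.length k (M →ₗ[A] A) + Module.length k (range (lcomp k A f)) := by
  have : ker (lcomp k A f) = range (lcomp k A p) := by
    ext φ
    rw [mem_range_lcomp_iff hp, ← h, LinearMap.range_le_ker_iff]
    rfl
  rw [length_eq_add_range (lcomp k A f), this,
    ← (LinearEquiv.ofInjective _ (lcomp_injective_of_surjective (k := k) hp)).length_eq]

theorem length_quotient_jacobson_ne_top [IsArtinianRing k] [Module.Finite k A] :
    Module.length k (A ⧸ Ring.jacobson A) ≠ ⊤ := by
  have : Module.Finite k (A ⧸ Ring.jacobson A) :=
    .of_surjective ((Ring.jacobson A).mkQ.restrictScalars k)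
      (Submodule.mkQ_surjective (Ring.jacobson A))
  exact Module.length_ne_top

variable [IsLocalRing A]

theorem length_eq_mul_length_of_isFiniteLength (hM : IsFiniteLength A M) :
    ∀ [Module k M] [IsScalarTower k A M],
      Module.length k M = Module.length k (A ⧸ Ring.jacobson A) * Module.length A M := by
  induction hM with
  | of_subsingleton =>
    intro _ _
    simp [Module.length_eq_zero]
  | @of_simple_quotient M _ _ N _ _ ih =>
    intro _ _
    obtain ⟨φ⟩ := nonempty_equiv_quotient_jacobson (A := A) (M ⧸ N)
    have h1 : Module.length k M = Module.length k N + Module.length k (M ⧸ N) :=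
      Module.length_eq_add_of_exact (N.subtype.restrictScalars k) (N.mkQ.restrictScalars k)
        N.injective_subtype N.mkQ_surjective (LinearMap.exact_subtype_mkQ N)
    rw [h1, length_eq_add_quotient N, ih, (φ.restrictScalars k).length_eq,
      Module.length_eq_one A (M ⧸ N), mul_add, mul_one]

theorem length_linearMap_le_of_isFiniteLength (hM : IsFiniteLength A M) :
    Module.length k (M →ₗ[A] A) ≤
      Module.length k ((A ⧸ Ring.jacobson A) →ₗ[A] A) * Module.length A M := by
  induction hM with
  | of_subsingleton => simp [Module.length_eq_zero]
  | @of_simple_quotient M _ _ N _ _ ih =>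
    obtain ⟨φ⟩ := nonempty_equiv_quotient_jacobson (A := A) (M ⧸ N)
    have h1 : Module.length k ((M ⧸ N) →ₗ[A] A) =
        Module.length k ((A ⧸ Ring.jacobson A) →ₗ[A] A) :=
      (φ.congrLeft A k).length_eq
    rw [length_linearMap_eq_add (f := N.subtype) N.mkQ_surjective (by simp),
      length_eq_add_quotient N, Module.length_eq_one A (M ⧸ N), mul_add, mul_one, h1, add_comm]
    exact add_le_add_left
      ((Module.length_le_of_injective _ (Submodule.injective_subtype _)).trans ih) _

theorem injective_of_length_linearMap_le [IsArtinianRing k] [Module.Finite k A]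
    (h : Module.length k ((A ⧸ Ring.jacobson A) →ₗ[A] A) ≤
      Module.length k (A ⧸ Ring.jacobson A)) : Module.Injective A A := by
  have : IsArtinianRing A := IsArtinianRing.of_finite k A
  refine Module.Baer.injective fun I φ => ?_
  have hfl (M : Type u) [AddCommGroup M] [Module A M] [Module.Finite A M] : IsFiniteLength A M :=
    isFiniteLength_iff_isNoetherian_isArtinian.2 ⟨inferInstance, inferInstance⟩
  have hle (M : Type u) [AddCommGroup M] [Module A M] [Module.Finite A M] :
      Module.length k (M →ₗ[A] A) ≤ Module.length k (A ⧸ Ring.jacobson A) * Module.length A M :=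
    (length_linearMap_le_of_isFiniteLength (hfl M)).trans (by gcongr)
  have htop (M : Type u) [AddCommGroup M] [Module A M] [Module.Finite A M] :
      Module.length k (A ⧸ Ring.jacobson A) * Module.length A M ≠ ⊤ := by
    exact WithTop.mul_ne_top length_quotient_jacobson_ne_top (Module.length_ne_top_iff.2 (hfl M))
  let ρ := lcomp k A I.subtype
  have h1 := length_linearMap_eq_add (k := k) (f := I.subtype) I.mkQ_surjective (by simp)
  rw [length_linearMap_of_equiv_pi (LinearEquiv.funUnique (Fin 1) A A).symm, Nat.cast_one, one_mul,
    length_eq_mul_length_of_isFiniteLength (hfl A), length_eq_add_quotient I, mul_add,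
    add_comm] at h1
  have h2 : Module.length k (I →ₗ[A] A) ≤ Module.length k (range ρ) := by
    refine (hle I).trans ?_
    refine (ENat.add_le_add_iff_left (htop (A ⧸ I))).1 (h1.le.trans ?_)
    gcongr
    exact hle _
  have h3 : range ρ = ⊤ := by
    by_contra h3
    obtain ⟨_, _⟩ := isFiniteLength_iff_isNoetherian_isArtinian.1
      (Module.length_ne_top_iff.1 (ne_top_of_le_ne_top (htop I) (hle I)))
    exact h2.not_gt (Submodule.length_lt h3)
  obtain ⟨ψ, hψ⟩ := LinearMap.range_eq_top.1 h3 φ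
  exact ⟨ψ, fun x hx => LinearMap.congr_fun hψ ⟨x, hx⟩⟩

end DualLength

section Recurrence

theorem eq_const_of_two_term_recurrence {t : ℤ → ℤ} {a e c m : ℤ} (ha : a ≠ 0)
    (h : ∀ i, t i + a * t (i - 1 - 1) = e * t (i - 1)) (hm : t m = c) (hm' : t (m - 1) = c)
    (hc : (1 + a) * c = e * c) (i : ℤ) : t i = c := by
  suffices t i = c ∧ t (i - 1) = c from this.1
  induction i using Int.inductionOn' (b := m) with
  | zero => exact ⟨hm, hm'⟩
  | succ j _ ih =>
    have := h (j + 1)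
    rw [add_sub_cancel_right, ih.1, ih.2] at this
    exact ⟨by linarith, by rw [add_sub_cancel_right]; exact ih.1⟩
  | pred j _ ih =>
    have := h j
    rw [ih.1, ih.2] at this
    exact ⟨ih.2, mul_left_cancel₀ ha (by linarith)⟩

/-- Comparing the two recurrences gives `t i = t (i - 2)` for two consecutive values of `i`. -/
theorem eq_const_of_dual_recurrences {t : ℤ → ℤ} {a e m : ℤ} (ha : 2 ≤ a) (he : 0 ≤ e)
    (h : ∀ i, t i + a * t (i - 1 - 1) = e * t (i - 1))
    (h' : ∀ i, m ≤ i → t (i - 1 - 1) + a * t i = e * t (i - 1)) (i : ℤ) : t i = t m := by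
  have hper (i : ℤ) (hi : m ≤ i) : t i = t (i - 1 - 1) :=
    mul_left_cancel₀ (show a - 1 ≠ 0 by omega) (by linear_combination h' i hi - h i)
  have h1 := h m
  have h2 := h (m + 1)
  have h3 := hper m le_rfl
  have h4 := hper (m + 1) (by omega)
  rw [add_sub_cancel_right] at h2 h4
  rw [← h3] at h1
  rw [← h4] at h2
  have h5 : t (m - 1) = t m := by
    rw [← h4]
    exact mul_left_cancel₀ (show 1 + a + e ≠ 0 by omega) (by rw [h4] at h2 ⊢; linarith)
  exact eq_const_of_two_term_recurrence (by omega) h rfl h5 (by rw [h5] at h1; linarith) i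

variable {A : Type u} [Ring A]

theorem length_eq_add_quotient_comap {M N : Type*} [AddCommGroup M] [Module A M] [AddCommGroup N]
    [Module A N] {f : M →ₗ[A] N} (hf : Function.Surjective f) (V : Submodule A N) :
    Module.length A M = Module.length A (V.comap f) + Module.length A (N ⧸ V) := by
  have hk : ker (V.mkQ ∘ₗ f) = V.comap f := by rw [LinearMap.ker_comp, Submodule.ker_mkQ]
  have hr : range (V.mkQ ∘ₗ f) = ⊤ :=
    LinearMap.range_eq_top.2 (V.mkQ_surjective.comp hf)
  rw [length_eq_add_range (V.mkQ ∘ₗ f), hk, hr, Module.length_top]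

theorem length_smul_top_eq {M : Type*} [AddCommGroup M] [Module A M] (I : Ideal A)
    (N : Submodule A M) :
    Module.length A (I • ⊤ : Submodule A N) = Module.length A (I • N : Submodule A M) := by
  have : (I • N : Submodule A M) = (I • ⊤ : Submodule A N).map N.subtype := by
    rw [Submodule.map_smul'', Submodule.map_subtype_top]
  rw [this]
  exact (Submodule.equivMapOfInjective _ N.injective_subtype _).length_eq

variable {Q : ℤ → Type u} [∀ i, AddCommGroup (Q i)] [∀ i, Module A (Q i)]
  {g : ∀ i : ℤ, Q i →ₗ[A] Q (i - 1)} (hg : ∀ i, range (g i) = ker (g (i - 1)))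
  (hmin : ∀ i, range (g i) ≤ Ring.jacobson A • ⊤)
include hg hmin

theorem ker_le_jacobson_smul_top (i : ℤ) : ker (g i) ≤ Ring.jacobson A • ⊤ := by
  obtain ⟨j, rfl⟩ : ∃ j, i = j - 1 := ⟨i + 1, by ring⟩
  exact hg j ▸ hmin j

theorem jacobson_sq_smul_top_le_range
    (hJ : Ring.jacobson A * (Ring.jacobson A * Ring.jacobson A) = ⊥) (i : ℤ) :
    (Ring.jacobson A * Ring.jacobson A) • (⊤ : Submodule A (Q (i - 1))) ≤ range (g i) := by
  intro x hx
  have hx' := Submodule.mem_map_of_mem (f := g (i - 1)) hx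
  rw [Submodule.map_smul'', Submodule.map_top] at hx'
  have := Submodule.smul_mono (le_refl (Ring.jacobson A * Ring.jacobson A)) (hmin (i - 1)) hx'
  rw [← Submodule.mul_smul, mul_assoc, hJ, Submodule.bot_smul, Submodule.mem_bot] at this
  rw [hg i]
  exact this

variable [IsLocalRing A] [IsArtinianRing A]
  (hJ : Ring.jacobson A * (Ring.jacobson A * Ring.jacobson A) = ⊥)
  (hr : ∀ i, ¬ HasSimpleRetract A (range (g i)))
  {t : ℤ → ℕ} (φ : ∀ i, Q i ≃ₗ[A] (Fin (t i) → A))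

include φ in
theorem length_top_range (i : ℤ) :
    Module.length A (range (g i) ⧸ (Ring.jacobson A • ⊤ : Submodule A (range (g i)))) = t i :=
  length_quotient_smul_top_of_surjective (φ i) (g i).rangeRestrict
    (LinearMap.surjective_rangeRestrict _)
    (by rw [LinearMap.ker_rangeRestrict]; exact ker_le_jacobson_smul_top hg hmin i)

include hJ hr

theorem jacobson_sq_smul_top_eq_smul_range (i : ℤ) :
    (Ring.jacobson A * Ring.jacobson A) • (⊤ : Submodule A (Q (i - 1))) =
      Ring.jacobson A • range (g i) :=
  jacobson_sq_smul_top_eq hJ (hmin i) (jacobson_sq_smul_top_le_range hg hmin hJ i) (hr i)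

include φ

theorem length_jacobson_smul_range (i : ℤ) :
    Module.length A (Ring.jacobson A • range (g i) : Submodule A (Q (i - 1))) =
      t (i - 1) * Module.length A (Ring.jacobson A * Ring.jacobson A : Ideal A) := by
  rw [← jacobson_sq_smul_top_eq_smul_range hg hmin hJ hr, length_smul_top_of_equiv_pi (φ (i - 1))]

theorem length_range_eq (i : ℤ) :
    Module.length A (range (g i)) =
      t (i - 1) * Module.length A (Ring.jacobson A * Ring.jacobson A : Ideal A) + t i := by
  rw [length_eq_add_quotient (Ring.jacobson A • ⊤ : Submodule A (range (g i))),
    length_top_range hg hmin φ, length_smul_top_eq, length_jacobson_smul_range hg hmin hJ hr φ]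

theorem rank_recurrence {a e : ℕ}
    (ha : Module.length A (Ring.jacobson A * Ring.jacobson A : Ideal A) = a)
    (he : Module.length A A = (1 + e + a : ℕ)) (i : ℤ) :
    t i + a * t (i - 1 - 1) = e * t (i - 1) := by
  have h1 := length_eq_add_range (g (i - 1))
  rw [← hg i, length_range_eq hg hmin hJ hr φ, length_range_eq hg hmin hJ hr φ, ha,
    length_of_equiv_pi (φ (i - 1)), he] at h1
  norm_cast at h1
  linarith

variable {k : Type u} [CommRing k] [Algebra k A] {a e d : ℕ}
  (ha : Module.length A (Ring.jacobson A * Ring.jacobson A : Ideal A) = a)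
  (he : Module.length A (Ring.jacobson A : Ideal A) = (e + a : ℕ))
  (hA : Module.length A A = (1 + e + a : ℕ))
  (hd : Module.length k (A ⧸ Ring.jacobson A) = d)
include ha he hA hd

theorem length_forms_range (hJJ : Ring.jacobson A * Ring.jacobson A ≠ ⊥) {i : ℤ}
    (hi : FormsExtend g i) :
    Module.length k (range (g i) →ₗ[A] A) = (d * (t (i - 1) + a * t i) : ℕ) := by
  have hfl (M : Type u) [AddCommGroup M] [Module A M] [IsNoetherian A M] [IsArtinian A M] :
      IsFiniteLength A M := isFiniteLength_iff_isNoetherian_isArtinian.2 ⟨‹_›, ‹_›⟩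
  have hρ : Function.Surjective (lcomp k A (range (g i)).subtype) := fun ψ => by
    obtain ⟨χ, hχ⟩ := hi ψ
    exact ⟨χ, LinearMap.ext hχ⟩
  have hV : (formsInto k (Ring.jacobson A * Ring.jacobson A) (range (g i))).comap
      (lcomp k A (range (g i)).subtype) = formsInto k (Ring.jacobson A) (Q (i - 1)) := by
    ext χ
    constructor
    · intro hχ
      exact forall_mem_jacobson_of_forall_mem_sq hJ hJJ
        (jacobson_sq_smul_top_eq_smul_range hg hmin hJ hr i) fun x hx => hχ ⟨x, hx⟩
    · intro hχ x
      exact forall_mem_sq_of_forall_mem_jacobson (hmin i) hχ x.2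
  have h1 := length_eq_add_quotient_comap hρ
    (formsInto k (Ring.jacobson A * Ring.jacobson A) (range (g i)))
  rw [hV, length_linearMap_of_equiv_pi (φ (i - 1)), length_formsInto_of_equiv_pi _ (φ (i - 1)),
    length_eq_mul_length_of_isFiniteLength (hfl A), hA,
    length_eq_mul_length_of_isFiniteLength (hfl (Ring.jacobson A)), he, hd] at h1
  have h2 : Module.length k (formsInto k (Ring.jacobson A * Ring.jacobson A) (range (g i))) =
      t i * (d * a) := by
    rw [length_formsInto_of_surjective (p := (g i).rangeRestrict)
      (LinearMap.surjective_rangeRestrict _), length_formsInto_of_equiv_pi _ (φ i),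
      length_eq_mul_length_of_isFiniteLength
        (hfl (Ring.jacobson A * Ring.jacobson A : Ideal A)), ha, hd]
    intro ψ hψ x hx
    rw [LinearMap.ker_rangeRestrict] at hx
    have hx' := Submodule.mem_map_of_mem (f := ψ) (ker_le_jacobson_smul_top hg hmin i hx)
    rw [Submodule.map_smul''] at hx'
    have hle : (⊤ : Submodule A (Q i)).map ψ ≤ Ring.jacobson A * Ring.jacobson A := by
      rintro _ ⟨z, -, rfl⟩
      exact hψ z
    have := Submodule.smul_mono (le_refl (Ring.jacobson A)) hle hx'
    rwa [smul_eq_mul, hJ, Submodule.mem_bot] at this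
  have h3 : Module.length k ((range (g i) →ₗ[A] A) ⧸
      formsInto k (Ring.jacobson A * Ring.jacobson A) (range (g i))) = (t (i - 1) * d : ℕ) := by
    refine ((ENat.addLECancellable_of_ne_top ?_).inj).1 (h1.symm.trans ?_)
    · exact_mod_cast ENat.natCast_ne_top (t (i - 1) * (d * (e + a)))
    · norm_cast
      ring
  rw [length_eq_add_quotient (formsInto k (Ring.jacobson A * Ring.jacobson A) (range (g i))),
    h2, h3]
  norm_cast
  ring

theorem dual_rank_recurrence (hJJ : Ring.jacobson A * Ring.jacobson A ≠ ⊥) (hd0 : d ≠ 0) {i : ℤ}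
    (hi : FormsExtend g i) (hi' : FormsExtend g (i - 1)) :
    t (i - 1 - 1) + a * t i = e * t (i - 1) := by
  have hfl : IsFiniteLength A A :=
    isFiniteLength_iff_isNoetherian_isArtinian.2 ⟨inferInstance, inferInstance⟩
  have hρ : Function.Surjective (lcomp k A (range (g i)).subtype) := fun ψ => by
    obtain ⟨χ, hχ⟩ := hi ψ
    exact ⟨χ, LinearMap.ext hχ⟩
  have h := length_linearMap_eq_add (k := k) (f := (range (g i)).subtype)
    (p := (g (i - 1)).rangeRestrict) (LinearMap.surjective_rangeRestrict _) (by simp [hg])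
  rw [LinearMap.range_eq_top.2 hρ, Module.length_top, length_linearMap_of_equiv_pi (φ (i - 1)),
    length_forms_range hg hmin hJ hr φ ha he hA hd hJJ hi,
    length_forms_range hg hmin hJ hr φ ha he hA hd hJJ hi',
    length_eq_mul_length_of_isFiniteLength hfl, hA, hd] at h
  norm_cast at h
  refine Nat.eq_of_mul_eq_mul_left (Nat.pos_of_ne_zero hd0) ?_
  linarith

end Recurrence

section ConstantRank

variable {A : Type u} [Ring A] {M : Type u} [AddCommGroup M] [Module A M]

theorem radLength_eq_length_smul (N : Submodule A M) :
    radLength A N = Module.length A (Ring.jacobson A • N : Submodule A M) := by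
  rw [radLength, lengthM, idealSMulSub_eq_smul, Ideal.jacobson_bot, Module.coe_length]

theorem topLength_eq_length_quotient_smul_top (N : Submodule A M) :
    topLength A N = Module.length A (N ⧸ (Ring.jacobson A • ⊤ : Submodule A N)) := by
  have h : (Ring.jacobson A • N).comap N.subtype = Ring.jacobson A • ⊤ := by
    ext x
    rw [Submodule.mem_smul_top_iff]
    rfl
  rw [topLength, lengthM, idealSMulSub_eq_smul, Ideal.jacobson_bot, h, Module.coe_length]

/-- If the socle of `A` lies in an ideal isomorphic to the simple module, then `A` is
self-injective. -/
theorem injective_of_annihilated_mem [IsLocalRing A] {k : Type u} [CommRing k]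
    [IsArtinianRing k] [Algebra k A] [Module.Finite k A] {I : Ideal A}
    (hI : Module.length A I = 1)
    (h : ∀ x : A, (∀ a ∈ Ring.jacobson A, a * x = 0) → x ∈ I) : Module.Injective A A := by
  have : IsArtinianRing A := IsArtinianRing.of_finite k A
  refine injective_of_length_linearMap_le (k := k) ?_
  have hmem (ψ : (A ⧸ Ring.jacobson A) →ₗ[A] A) :
      lcomp k A (Ring.jacobson A).mkQ ψ ∈ formsInto k I A := fun x => h _ fun a ha => by
    rw [← smul_eq_mul, ← map_smul, smul_eq_mul]
    have hax : (Ring.jacobson A).mkQ (a * x) = 0 :=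
      (Submodule.Quotient.mk_eq_zero _).2 (Ideal.mul_mem_right x _ ha)
    rw [lcomp_apply, hax, map_zero]
  have hinj := lcomp_injective_of_surjective (k := k) (Ring.jacobson A).mkQ_surjective
  calc Module.length k ((A ⧸ Ring.jacobson A) →ₗ[A] A)
      ≤ Module.length k (formsInto k I A) :=
        Module.length_le_of_injective ((lcomp k A (Ring.jacobson A).mkQ).codRestrict _ hmem)
          fun ψ χ hψχ => hinj (congrArg Subtype.val hψχ)
    _ = Module.length k (A ⧸ Ring.jacobson A) := by
      rw [length_formsInto_of_equiv_pi I (LinearEquiv.funUnique (Fin 1) A A).symm,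
        length_eq_mul_length_of_isFiniteLength (A := A)
          (isFiniteLength_iff_isNoetherian_isArtinian.2 ⟨inferInstance, inferInstance⟩), hI]
      simp

variable {Q : ℤ → Type u} [∀ i, AddCommGroup (Q i)] [∀ i, Module A (Q i)]
  [IsLocalRing A] [IsArtinianRing A] {t : ℤ → ℕ}

theorem exists_forall_rank_eq {k : Type u} [CommRing k] [IsArtinianRing k] [Algebra k A]
    [Module.Finite k A] [∀ i, Module.Projective A (Q i)] (hA : ¬ Module.Injective A A)
    (hJ : Ring.jacobson A * (Ring.jacobson A * Ring.jacobson A) = ⊥) {e a : ℕ}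
    (hlJJ : Module.length A (Ring.jacobson A * Ring.jacobson A : Ideal A) = a)
    (hlJ : Module.length A (Ring.jacobson A : Ideal A) = (e + a : ℕ))
    (hlA : Module.length A A = (1 + e + a : ℕ))
    (g : ∀ i : ℤ, Q i →ₗ[A] Q (i - 1)) (hg : ∀ i, range (g i) = ker (g (i - 1)))
    (hmin : ∀ i, range (g i) ≤ Ring.jacobson A • ⊤) (φ : ∀ i, Q i ≃ₗ[A] (Fin (t i) → A))
    {i₀ : ℤ} (hs : sGp A (range (g i₀))) : ∃ c, ∀ i, t i = c := by
  have hr := not_hasSimpleRetract_range hA g hg hs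
  have hrec := rank_recurrence hg hmin hJ hr φ hlJJ hlA
  have hzero {i : ℤ} (hi : range (g i) = ⊥) : t i = 0 := by
    have h := length_top_range hg hmin φ i
    have : Subsingleton (range (g i)) := (Submodule.subsingleton_iff_eq_bot).2 hi
    rw [Module.length_eq_zero] at h
    exact_mod_cast h.symm
  have hext {i : ℤ} (hi : i₀ < i) : FormsExtend g i := formsExtend_of_sGp g hg hs hi
  rcases Nat.eq_zero_or_pos a with rfl | ha
  · have hJJ : Ring.jacobson A * Ring.jacobson A = ⊥ := by
      rw [← Submodule.subsingleton_iff_eq_bot, ← Module.length_eq_zero_iff (R := A), hlJJ]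
      rfl
    refine ⟨0, fun i => hzero ?_⟩
    have hsmul := jacobson_sq_smul_top_eq_smul_range hg hmin hJ hr i
    rw [hJJ, Submodule.bot_smul] at hsmul
    by_contra hne
    obtain ⟨w, hw, hw0⟩ := (Submodule.ne_bot_iff _).1 hne
    refine hr i (hasSimpleRetract_of_notMem (w := ⟨w, hw⟩) (fun h => hw0 ?_) fun x hx => ?_)
    · rw [Submodule.mem_smul_top_iff, ← hsmul] at h
      exact h
    · have := Submodule.smul_mem_smul hx hw
      rw [← hsmul] at this
      exact Subtype.ext this
  have hJJ : Ring.jacobson A * Ring.jacobson A ≠ ⊥ := fun h => ha.ne' (by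
    rw [← Submodule.subsingleton_iff_eq_bot, ← Module.length_eq_zero_iff (R := A), hlJJ] at h
    exact_mod_cast h)
  have hconst (c : ℤ) (h : ∀ i, (t i : ℤ) = c) : ∃ c, ∀ i, t i = c :=
    ⟨t 0, fun i => by exact_mod_cast (h i).trans (h 0).symm⟩
  have hrecZ (i : ℤ) : (t i : ℤ) + a * t (i - 1 - 1) = e * t (i - 1) := by exact_mod_cast hrec i
  obtain rfl | ha2 : a = 1 ∨ 2 ≤ a := by omega
  · have hvan {i : ℤ} (hi : i₀ < i) : (t i : ℤ) = 0 := by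
      rw [Nat.cast_eq_zero]
      refine hzero ?_
      by_contra hne
      exact hA (injective_of_annihilated_mem (k := k) (by simpa using hlJJ) fun x hx =>
        mem_jacobson_sq_of_annihilated hJ hJJ (hmin i)
          (jacobson_sq_smul_top_le_range hg hmin hJ i) hne (hext hi) hx)
    exact hconst 0 (eq_const_of_two_term_recurrence (t := fun i => t i) (m := i₀ + 2)
      (by simp) hrecZ (hvan (by omega)) (hvan (by omega)) (by simp))
  · obtain ⟨d, hd⟩ := ENat.ne_top_iff_exists.1 (length_quotient_jacobson_ne_top (k := k) (A := A))
    have hd0 : d ≠ 0 := by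
      rintro rfl
      have := IsSimpleModule.nontrivial A (A ⧸ Ring.jacobson A)
      exact not_subsingleton (A ⧸ Ring.jacobson A) (Module.length_eq_zero_iff.1 hd.symm)
    refine hconst _ (eq_const_of_dual_recurrences (t := fun i => t i) (m := i₀ + 2) (a := a)
      (by exact_mod_cast ha2) (by positivity) hrecZ fun i hi => ?_)
    exact_mod_cast dual_rank_recurrence hg hmin hJ hr φ hlJJ hlJ hlA hd.symm hJJ hd0
      (hext (by omega)) (hext (by omega))

end ConstantRank

/-- Proposition 4.2(a): over a short local artin algebra of Hilbert type `(e, a)` which is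
not self-injective, if `Q_•` is an acyclic minimal complex of projective modules such that
some image `N_{i₀}` is semi-Gorenstein-projective, then all `Q_i` are free of the same rank
`t` and every image `N_j` has dimension vector `(t, a·t)`. -/
theorem short_local_acyclic_complex_constant_rank (k : Type u) [CommRing k] [IsArtinianRing k]
    (A : Type u) [Ring A] [Algebra k A] [Module.Finite k A] [IsLocalRing A]
    (hshort : ∀ x ∈ Ideal.jacobson (⊥ : Ideal A), ∀ y ∈ Ideal.jacobson (⊥ : Ideal A),
      ∀ z ∈ Ideal.jacobson (⊥ : Ideal A), x * y * z = 0)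
    (e a : ℕ)
    (hhilb_e : topLength A ((Ideal.jacobson (⊥ : Ideal A)) : Submodule A A)
        = ((e : ℕ∞) : WithBot ℕ∞))
    (hhilb_a : lengthM A
        (↥(idealSMulSub A (Ideal.jacobson ⊥) ((Ideal.jacobson (⊥ : Ideal A)) : Submodule A A)))
        = ((a : ℕ∞) : WithBot ℕ∞))
    (hnsi : ¬ Module.Injective A A)
    (Q : ℤ → Type u) [∀ i, AddCommGroup (Q i)] [∀ i, Module A (Q i)]
    (g : ∀ i : ℤ, Q i →ₗ[A] Q (i-1))
    (hcx : IsComplexZ A Q g) (hmin : IsMinimalZ A Q g) (hproj : IsProjComplexZ A Q)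
    (hacyc : ∀ i : ℤ, ExactAtPred A Q g i)
    (hsgp : ∃ i₀ : ℤ, sGp A (↥(range (g i₀)))) :
    ∃ t : ℕ, (∀ i : ℤ, Nonempty ((Q i) ≃ₗ[A] (Fin t → A))) ∧
      ∀ j : ℤ, topLength A (range (g j)) = ((t : ℕ∞) : WithBot ℕ∞) ∧
        radLength A (range (g j)) = (((a * t : ℕ) : ℕ∞) : WithBot ℕ∞) := by
  have : IsArtinianRing A := IsArtinianRing.of_finite k A
  have hP i : Module.Projective A (Q i) := (hproj i).1
  have hF i : Module.Finite A (Q i) := (hproj i).2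
  rw [Ideal.jacobson_bot] at hshort
  have hJ : Ring.jacobson A * (Ring.jacobson A * Ring.jacobson A) = ⊥ := by
    rw [← mul_assoc, eq_bot_iff, ← smul_eq_mul, Submodule.smul_le]
    intro w hw z hz
    rw [← smul_eq_mul] at hw
    refine Submodule.smul_induction_on hw (fun x hx y hy => hshort x hx y hy z hz) ?_
    intro x y hx hy
    rw [add_smul]
    exact Submodule.add_mem _ hx hy
  have hlJJ : Module.length A (Ring.jacobson A * Ring.jacobson A : Ideal A) = a := by
    change radLength A _ = _ at hhilb_a
    rw [radLength_eq_length_smul, Ideal.jacobson_bot] at hhilb_a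
    exact_mod_cast hhilb_a
  have hlJ : Module.length A (Ring.jacobson A : Ideal A) = (e + a : ℕ) := by
    rw [topLength_eq_length_quotient_smul_top, Ideal.jacobson_bot, WithBot.coe_inj] at hhilb_e
    rw [length_eq_add_quotient (Ring.jacobson A • ⊤ : Submodule A (Ring.jacobson A)),
      length_smul_top_eq, smul_eq_mul, hlJJ, hhilb_e, add_comm, Nat.cast_add]
  have hlA : Module.length A A = (1 + e + a : ℕ) := by
    rw [length_eq_add_quotient (Ring.jacobson A), hlJ, Module.length_eq_one A (A ⧸ _)]
    norm_cast
    ring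
  have hmin' i : range (g i) ≤ Ring.jacobson A • ⊤ := by
    rw [← radM_eq_jacobson_smul_top]
    exact hmin i
  obtain ⟨i₀, hs⟩ := hsgp
  choose t φ using fun i => exists_equiv_pi_of_projective (A := A) (Q i)
  replace φ i := (φ i).some
  obtain ⟨c, hc⟩ := exists_forall_rank_eq (k := k) hnsi hJ hlJJ hlJ hlA g hacyc hmin' φ hs
  obtain rfl : t = fun _ => c := funext hc
  have hr := not_hasSimpleRetract_range hnsi g hacyc hs
  refine ⟨c, fun i => ⟨φ i⟩, fun j => ⟨?_, ?_⟩⟩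
  · rw [topLength_eq_length_quotient_smul_top, length_top_range hacyc hmin' φ]
  · rw [radLength_eq_length_smul, length_jacobson_smul_range hacyc hmin' hJ hr φ, hlJJ, mul_comm,
      Nat.cast_mul]
end

section
/- Let A be a short local artin algebra and M a finitely generated left A-module such that both M and M* are semi-Gorenstein-projective. Then the kernel and the cokernel of the canonical map φ_M : M → M** have the same length. Consequently, if φ_M is a monomorphism or an epimorphism, then φ_M is an isomorphism, and M is Gorenstein-projective. -/
/-!
Common background: `A` is an artin algebra (an algebra over a commutative artinian
ring `k`, finitely generated as `k`-module).  Left `A`-modules are `Module A M`;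
right `A`-modules are `Module Aᵐᵒᵖ N`.  `Dl A M = Hom_A(M,A)` is the `A`-dual of a
left module (a right module) and `Dr A N` the dual of a right module (a left module);
`evalL A M : M → M**` is the canonical evaluation map `φ_M`.
-/

open CategoryTheory LinearMap

universe u

/-- `M` is Gorenstein-projective: both `M` and `M^*` are semi-Gorenstein-projective and
`φ_M` is an isomorphism. -/
def GorensteinProj (A : Type u) [Ring A] (M : Type u) [AddCommGroup M] [Module A M] : Prop :=
  sGp A M ∧ sGpR A (Dl A M) ∧ Function.Bijective (evalL A M)

section ExtVanishing

variable {R : Type u} [Ring R]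

/-- Vanishing of `Ext^n_R(X, Y)`, computed in the derived category. -/
def ExtVanish (R : Type u) [Ring R] (X Y : Type u) [AddCommGroup X] [Module R X]
    [AddCommGroup Y] [Module R Y] (n : ℕ) : Prop :=
  ∀ x : Abelian.Ext.{u} (ModuleCat.of R X) (ModuleCat.of R Y) n, x = 0

variable {X X' K F Y : Type u} [AddCommGroup X] [Module R X] [AddCommGroup X'] [Module R X']
  [AddCommGroup K] [Module R K] [AddCommGroup F] [Module R F] [AddCommGroup Y] [Module R Y]

lemma extVanish_of_extZero {n : ℕ} (h : extZero R X Y (n + 1)) : ExtVanish R X Y (n + 1) := by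
  intro x
  let P := ProjectiveResolution.of (ModuleCat.of R X)
  obtain ⟨f, hf, rfl⟩ := P.extMk_surjective x (n + 2) rfl
  rw [P.extMk_eq_zero_iff f _ rfl hf n rfl]
  have h' := h.of_iso (P.isoExt (R := ℤ) (n + 1) (ModuleCat.of R Y)).symm
  rw [← HomologicalComplex.exactAt_iff_isZero_homology,
    HomologicalComplex.exactAt_iff' _ n (n + 1) (n + 2) (by simp) (by simp),
    ShortComplex.moduleCat_exact_iff] at h'
  exact h' f hf

lemma ExtVanish.of_retract {n : ℕ} (i : X →ₗ[R] X') (p : X' →ₗ[R] X) (hpi : p ∘ₗ i = LinearMap.id)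
    (h : ExtVanish R X' Y n) : ExtVanish R X Y n := by
  intro x
  have hc : ModuleCat.ofHom i ≫ ModuleCat.ofHom p = 𝟙 (ModuleCat.of R X) := by
    rw [← ModuleCat.ofHom_comp, hpi]; rfl
  have h0 := h ((Abelian.Ext.mk₀ (ModuleCat.ofHom p)).comp x (zero_add n))
  have h1 : (Abelian.Ext.mk₀ (ModuleCat.ofHom i)).comp
      ((Abelian.Ext.mk₀ (ModuleCat.ofHom p)).comp x (zero_add n)) (zero_add n) = x := by
    rw [Abelian.Ext.mk₀_comp_mk₀_assoc, hc, Abelian.Ext.mk₀_id_comp]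
  rw [← h1, h0, Abelian.Ext.comp_zero]

variable {f : K →ₗ[R] F} {g : F →ₗ[R] X}

lemma shortExact_of_linearMap (hf : Function.Injective f) (hfg : Function.Exact f g)
    (hg : Function.Surjective g) :
    (ShortComplex.mk (ModuleCat.ofHom f) (ModuleCat.ofHom g)
      (by rw [← ModuleCat.ofHom_comp, hfg.linearMap_comp_eq_zero]; rfl)).ShortExact where
  exact := by
    rw [ShortComplex.moduleCat_exact_iff]
    exact fun x hx => (hfg x).1 hx
  mono_f := (ModuleCat.mono_iff_injective _).2 hf
  epi_g := (ModuleCat.epi_iff_surjective _).2 hg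

lemma ExtVanish.syzygy [Module.Projective R F] (hf : Function.Injective f)
    (hfg : Function.Exact f g) (hg : Function.Surjective g) {n : ℕ}
    (h : ExtVanish R X Y (n + 2)) : ExtVanish R K Y (n + 1) := by
  intro x
  have hS := shortExact_of_linearMap hf hfg hg
  obtain ⟨y, hy⟩ := Abelian.Ext.contravariant_sequence_exact₁ hS (ModuleCat.of R Y) x
    (add_comm 1 (n + 1)) (h _)
  have : Projective (ModuleCat.of R F) :=
    (IsProjective.iff_projective (R := R) F).1 inferInstance
  rw [← hy, Abelian.Ext.eq_zero_of_projective (P := ModuleCat.of R F) y, Abelian.Ext.comp_zero]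

lemma ExtVanish.cosyzygy [Module.Projective R F] (hf : Function.Injective f)
    (hfg : Function.Exact f g) (hg : Function.Surjective g) {n : ℕ}
    (h : ExtVanish R K Y n) : ExtVanish R X Y (n + 1) := by
  intro x
  have hS := shortExact_of_linearMap hf hfg hg
  have : Projective (ModuleCat.of R F) :=
    (IsProjective.iff_projective (R := R) F).1 inferInstance
  obtain ⟨y, hy⟩ := Abelian.Ext.contravariant_sequence_exact₃ hS (ModuleCat.of R Y) x
    (Abelian.Ext.eq_zero_of_projective (P := ModuleCat.of R F) _) (add_comm 1 n)
  rw [← hy, h y, Abelian.Ext.comp_zero]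

lemma ExtVanish.middle (hf : Function.Injective f)
    (hfg : Function.Exact f g) (hg : Function.Surjective g) {n : ℕ}
    (hK : ExtVanish R K Y n) (hX : ExtVanish R X Y n) : ExtVanish R F Y n := by
  intro x
  have hS := shortExact_of_linearMap hf hfg hg
  obtain ⟨y, hy⟩ := Abelian.Ext.contravariant_sequence_exact₂ hS (ModuleCat.of R Y) x (hK _)
  rw [← hy, hX y, Abelian.Ext.comp_zero]

lemma ExtVanish.exists_extension (hf : Function.Injective f)
    (hfg : Function.Exact f g) (hg : Function.Surjective g)
    (h : ExtVanish R X Y 1) (q : K →ₗ[R] Y) : ∃ q' : F →ₗ[R] Y, q' ∘ₗ f = q := by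
  have hS := shortExact_of_linearMap hf hfg hg
  obtain ⟨y, hy⟩ := Abelian.Ext.contravariant_sequence_exact₁ hS (ModuleCat.of R Y)
    (Abelian.Ext.mk₀ (ModuleCat.ofHom q)) (add_zero 1) (h _)
  obtain ⟨y, rfl⟩ := (Abelian.Ext.homEquiv₀ (X := ModuleCat.of R F)).symm.surjective y
  refine ⟨y.hom, ?_⟩
  rw [Abelian.Ext.homEquiv₀_symm_apply, Abelian.Ext.mk₀_comp_mk₀] at hy
  have := (Abelian.Ext.homEquiv₀ (X := ModuleCat.of R K)).symm.injective hy
  exact congrArg ModuleCat.Hom.hom this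

lemma ExtVanish.of_linearEquiv {n : ℕ} (e : X ≃ₗ[R] X') (h : ExtVanish R X' Y n) :
    ExtVanish R X Y n :=
  h.of_retract e.toLinearMap e.symm.toLinearMap (by ext; simp)

lemma ExtVanish.of_subsingleton [Subsingleton X] {n : ℕ} : ExtVanish R X Y n := by
  intro x
  have : 𝟙 (ModuleCat.of R X) = 0 := by
    ext x
    exact Subsingleton.elim (α := X) _ _
  rw [← Abelian.Ext.mk₀_id_comp x, this, Abelian.Ext.mk₀_zero, Abelian.Ext.zero_comp]

/-- If `Ext^n(S, Y)` vanishes for all simple modules `S`, it vanishes for all modules of finite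
length. -/
lemma ExtVanish.of_isFiniteLength {n : ℕ}
    (hS : ∀ (S : Type u) [AddCommGroup S] [Module R S], IsSimpleModule R S → ExtVanish R S Y n)
    (hX : IsFiniteLength R X) : ExtVanish R X Y n := by
  induction hX with
  | of_subsingleton => exact ExtVanish.of_subsingleton
  | @of_simple_quotient M _ _ N _ _ ih =>
    exact ih.middle N.injective_subtype (LinearMap.exact_subtype_mkQ N) N.mkQ_surjective
      (hS _ inferInstance)

end ExtVanishing

section NumericalRecursion

lemma eq_of_alternating_le {x y c : ℕ → ℕ} (hx : ∀ i, x i + x (i + 1) = c i)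
    (hy : ∀ i, y i + y (i + 1) = c i) (j : ℕ) (h₁ : x j ≤ y j) (h₂ : x (j + 1) ≤ y (j + 1)) :
    x 0 = y 0 := by
  have key : ∀ j, x j = y j → x 0 = y 0 := by
    intro j
    induction j with
    | zero => exact id
    | succ j ih =>
      intro h
      have := hx j
      have := hy j
      exact ih (by omega)
  have := hx j
  have := hy j
  exact key j (by omega)

lemma exists_eventually_const_of_succ_le {u : ℕ → ℕ} (h : ∀ i, u (i + 1) ≤ u i) :
    ∃ j, ∀ i, j ≤ i → u (i + 1) = u i := by
  obtain ⟨j, hj⟩ := WellFoundedGT.monotone_chain_condition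
    (⟨fun i => OrderDual.toDual (u i), monotone_nat_of_le_succ h⟩ : ℕ →o ℕᵒᵈ)
  refine ⟨j, fun i hi => ?_⟩
  have h₁ : u j = u i := hj i hi
  have h₂ : u j = u (i + 1) := hj (i + 1) (by omega)
  omega

/-- Betti numbers satisfying the recursion of an acyclic complex over a short local ring are
eventually constant, unless the two outer coefficients agree. -/
lemma eventually_const_of_recursion {s E B : ℕ} {t : ℕ → ℕ} (hs : 0 < s)
    (hE : E = 0 ∨ s ≤ E) (hB : B = 0 ∨ s ≤ B)
    (h₁ : ∀ i, E * t (i + 1) = s * t i + B * t (i + 2))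
    (h₂ : ∀ i, E * t (i + 1) ≤ s * t (i + 2) + B * t i) (hBs : B ≠ s) :
    ∃ j, ∀ i, j ≤ i → t (i + 1) = t i := by
  rcases hB with rfl | hB
  · apply exists_eventually_const_of_succ_le
    intro i
    have := h₁ i
    rcases hE with rfl | hE
    · have := h₁ (i + 1)
      simp at this
      rcases this with h | h <;> omega
    · nlinarith
  · have h₃ : ∀ i, t (i + 2) ≤ t i := by
      intro i
      have := h₁ i
      have := h₂ i
      have hlt : s < B := by omega
      nlinarith
    obtain ⟨j, hj⟩ := exists_eventually_const_of_succ_le (u := fun i => t i + t (i + 1))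
      (fun i => by have := h₃ i; show t (i + 1) + t (i + 2) ≤ t i + t (i + 1); omega)
    refine ⟨j, fun i hi => ?_⟩
    have e₁ : t (i + 1) + t (i + 2) = t i + t (i + 1) := hj i hi
    have e₂ : t (i + 2) + t (i + 3) = t (i + 1) + t (i + 2) := hj (i + 1) (by omega)
    have e₃ : t (i + 2) = t i := by omega
    have e₄ : t (i + 3) = t (i + 1) := by omega
    have r₁ := h₁ i
    have r₂ : E * t (i + 2) = s * t (i + 1) + B * t (i + 3) := h₁ (i + 1)
    rw [e₃] at r₁ r₂
    rw [e₄] at r₂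
    rcases lt_trichotomy (t (i + 1)) (t i) with h | h | h
    · nlinarith
    · exact h
    · nlinarith

lemma length_eq_of_recursions {s E B : ℕ} {t q m z n w : ℕ → ℕ} (hs : 0 < s)
    (hE : E = 0 ∨ s ≤ E) (hB : B = 0 ∨ s ≤ B)
    (hm : ∀ i, m i + m (i + 1) = t i * (s + E + B))
    (hz : ∀ i, z i + z (i + 1) = t i * (s + E + B))
    (hn : ∀ i, n i + n (i + 1) = q i * (s + E + B))
    (hw : ∀ i, w i + w (i + 1) = q i * (s + E + B))
    (hzn : n 0 = z 0)
    (hm' : ∀ i, m (i + 1) ≤ t (i + 1) * s + t i * B)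
    (hz' : ∀ i, z (i + 1) = t i * s + t (i + 1) * B)
    (hn' : ∀ i, n (i + 1) = q (i + 1) * s + q i * B)
    (hn₀ : n 0 = q 0 * s + t 0 * B)
    (hw' : ∀ i, w (i + 1) ≤ q i * s + q (i + 1) * B) :
    m 0 = w 0 := by
  have hzrec : ∀ i, E * t (i + 1) = s * t i + B * t (i + 2) := fun i => by
    linear_combination -hz (i + 1) + hz' i + hz' (i + 1)
  have hmrec : ∀ i, E * t (i + 1) ≤ s * t (i + 2) + B * t i := fun i => by
    linarith [hm (i + 1), hm' i, hm' (i + 1)]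
  have hjoint₀ : E * t 0 = s * q 0 + B * t 1 := by
    linear_combination -hz 0 + hz' 0 - hzn + hn₀
  have hjoint₁ : E * q 0 = B * t 0 + s * q 1 := by
    linear_combination -hn 0 + hn' 0 + hn₀
  have hnrec : ∀ i, E * q (i + 1) = s * q (i + 2) + B * q i := fun i => by
    linear_combination -hn (i + 1) + hn' i + hn' (i + 1)
  by_cases hBs : B = s
  · subst hBs
    have hmz : m 0 = z 0 := eq_of_alternating_le hm hz 1
      (by linarith [hm' 0, hz' 0]) (by linarith [hm' 1, hz' 1])
    have hwn : w 0 = n 0 := eq_of_alternating_le hw hn 1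
      (by linarith [hn' 0, hw' 0]) (by linarith [hn' 1, hw' 1])
    omega
  · obtain ⟨j, hj⟩ := eventually_const_of_recursion hs hE hB hzrec hmrec hBs
    have hmz : m 0 = z 0 := by
      apply eq_of_alternating_le hm hz (j + 1)
      · linarith [hm' j, hz' j, hj j le_rfl, congrArg (s * ·) (hj j le_rfl),
          congrArg (B * ·) (hj j le_rfl)]
      · linarith [hm' (j + 1), hz' (j + 1), congrArg (s * ·) (hj (j + 1) (by omega)),
          congrArg (B * ·) (hj (j + 1) (by omega))]
    have hback : ∀ i, t (j - i) = t j ∧ t (j - i + 1) = t j := by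
      intro i
      induction i with
      | zero => exact ⟨rfl, hj j le_rfl⟩
      | succ i ih =>
        rcases Nat.lt_or_ge i j with h | h
        · obtain ⟨l, hl⟩ : ∃ l, j = i + 1 + l := ⟨j - (i + 1), by omega⟩
          have e₁ : j - i = l + 1 := by omega
          have e₂ : j - (i + 1) = l := by omega
          rw [e₁] at ih
          rw [e₂]
          refine ⟨?_, ih.1⟩
          have r₁ := hzrec l
          have r₂ := hzrec j
          rw [hj (j + 1) (by omega), hj j le_rfl] at r₂
          rw [ih.1, ih.2] at r₁
          have : s * t l = s * t j := by omega
          exact Nat.eq_of_mul_eq_mul_left hs this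
        · have e : j - (i + 1) = j - i := by omega
          rw [e]
          exact ih
    set c := t j with hc
    have ht₀ : t 0 = c := by simpa using (hback j).1
    have ht₁ : t 1 = c := by simpa using (hback j).2
    have hEc : E * c = s * c + B * c := by
      have r := hzrec j
      rw [hj (j + 1) (by omega), hj j le_rfl] at r
      exact r
    have hq₀ : q 0 = c := by
      rw [ht₀, ht₁] at hjoint₀
      exact Nat.eq_of_mul_eq_mul_left hs (by omega)
    have hq₁ : q 1 = c := by
      rw [ht₀, hq₀] at hjoint₁
      exact Nat.eq_of_mul_eq_mul_left hs (by omega)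
    have hq₂ : q 2 = c := by
      have r := hnrec 0
      simp only [zero_add, hq₀, hq₁] at r
      exact Nat.eq_of_mul_eq_mul_left hs (by omega)
    have hwn : w 0 = n 0 := by
      have a₁ := hn' 0
      have a₂ := hn' 1
      have a₃ := hw' 0
      have a₄ := hw' 1
      simp only [zero_add, Nat.reduceAdd, hq₀, hq₁, hq₂] at a₁ a₂ a₃ a₄
      exact eq_of_alternating_le hw hn 1 (by omega) (by simpa using by omega)
    omega

end NumericalRecursion

section KLength

/-- The length of a module as a natural number (zero if the length is infinite). -/
noncomputable def klen (k X : Type u) [Ring k] [AddCommGroup X] [Module k X] : ℕ :=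
  (Module.length k X).toNat

variable {k X Y Z : Type u} [CommRing k] [AddCommGroup X] [Module k X]
  [AddCommGroup Y] [Module k Y] [AddCommGroup Z] [Module k Z]

lemma klen_congr (e : X ≃ₗ[k] Y) : klen k X = klen k Y := by
  rw [klen, klen, e.length_eq]

lemma klen_pi (n : ℕ) : klen k (Fin n → X) = n * klen k X := by
  rw [klen, Module.length_pi, ENat.toNat_mul]
  simp [klen]

lemma klen_submodule_pi (J : Submodule k X) (n : ℕ) :
    klen k (Submodule.pi Set.univ fun _ : Fin n => J) = n * klen k J := by
  rw [← klen_pi]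
  exact klen_congr
    { toFun := fun x i => ⟨x.1 i, x.2 i trivial⟩
      invFun := fun x => ⟨fun i => x i, fun i _ => (x i).2⟩
      map_add' := fun _ _ => rfl
      map_smul' := fun _ _ => rfl
      left_inv := fun _ => rfl
      right_inv := fun _ => rfl }

variable [IsArtinianRing k]

lemma coe_klen [Module.Finite k X] : (klen k X : ℕ∞) = Module.length k X :=
  ENat.natCast_toNat Module.length_ne_top

lemma klen_eq_add [Module.Finite k Y] {f : X →ₗ[k] Y} {g : Y →ₗ[k] Z}
    (hf : Function.Injective f) (hg : Function.Surjective g) (hfg : Function.Exact f g) :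
    klen k Y = klen k X + klen k Z := by
  have := Module.Finite.of_injective f hf
  have := Module.Finite.of_surjective g hg
  have h := Module.length_eq_add_of_exact f g hf hg hfg
  rw [← coe_klen, ← coe_klen, ← coe_klen] at h
  exact_mod_cast h

lemma klen_le_of_injective [Module.Finite k Y] (f : X →ₗ[k] Y) (hf : Function.Injective f) :
    klen k X ≤ klen k Y :=
  (klen_eq_add hf (range f).mkQ_surjective (exact_map_mkQ_range f)).symm ▸ Nat.le_add_right _ _

lemma klen_eq_ker_add_range [Module.Finite k X] (f : X →ₗ[k] Y) :
    klen k X = klen k (ker f) + klen k (range f) :=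
  klen_eq_add (ker f).injective_subtype f.surjective_rangeRestrict
    (by rw [LinearMap.exact_iff]; simp)

lemma klen_eq_quotient_add [Module.Finite k X] (U : Submodule k X) :
    klen k X = klen k U + klen k (X ⧸ U) :=
  klen_eq_add U.injective_subtype U.mkQ_surjective (exact_subtype_mkQ U)

lemma klen_le_of_le [Module.Finite k X] {U V : Submodule k X} (h : U ≤ V) :
    klen k U ≤ klen k V :=
  klen_le_of_injective (Submodule.inclusion h) (Submodule.inclusion_injective h)

lemma klen_eq_zero_iff [Module.Finite k X] : klen k X = 0 ↔ Subsingleton X := by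
  rw [← Module.length_eq_zero_iff (R := k), ← coe_klen]
  simp

lemma klen_pi_eq [Module.Finite k X] (J : Submodule k X) (n : ℕ) :
    klen k (Fin n → X) =
      klen k (Submodule.pi Set.univ fun _ : Fin n => J) + n * klen k (X ⧸ J) := by
  rw [klen_pi, klen_submodule_pi, klen_eq_quotient_add J, mul_add]

variable [Module.Finite k X] {J J₂ : Submodule k X} {a b : ℕ}
  {p : (Fin a → X) →ₗ[k] Y} {ι : Y →ₗ[k] (Fin b → X)}

/-- A quotient of `X ^ a` embedded into `X ^ b` such that the image of `J ^ a` lies in `J₂ ^ b`. -/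
lemma klen_le_of_cover_of_embedding (hp : Function.Surjective p) (hι : Function.Injective ι)
    (h : ∀ y, (∀ i, y i ∈ J) → ∀ i, ι (p y) i ∈ J₂) :
    klen k Y ≤ a * klen k (X ⧸ J) + b * klen k J₂ := by
  let P : Submodule k (Fin a → X) := Submodule.pi Set.univ fun _ => J
  let Q : Submodule k (Fin b → X) := Submodule.pi Set.univ fun _ => J₂
  let ψ : P →ₗ[k] Q := (ι ∘ₗ p).restrict fun y hy i _ => h y (fun j => hy j trivial) i
  have h₁ := klen_eq_ker_add_range ψ
  have h₂ : klen k (range ψ) ≤ klen k Q := klen_le_of_injective _ (range ψ).injective_subtype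
  have h₃ : klen k (ker ψ) ≤ klen k (ker p) := by
    refine klen_le_of_injective
      ((P.subtype ∘ₗ (ker ψ).subtype).codRestrict (ker p) fun y => ?_) ?_
    · have hy : ι (p y.1.1) = 0 := congrArg Subtype.val y.2
      exact hι (hy.trans (map_zero ι).symm)
    · intro x y hxy
      exact Subtype.ext (Subtype.ext (congrArg (fun z : ker p => z.1) hxy))
  have h₄ := klen_eq_add (ker p).injective_subtype hp (exact_subtype_ker_map p)
  have h₅ := klen_pi_eq (k := k) J a
  have h₆ : klen k Q = b * klen k J₂ := klen_submodule_pi J₂ b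
  change _ = klen k P + _ at h₅
  omega

lemma klen_eq_of_cover_of_embedding (hp : Function.Surjective p)
    (h : ∀ y, (∀ i, y i ∈ J) → ∀ i, ι (p y) i ∈ J₂)
    (hker : ∀ y, p y = 0 → ∀ i, y i ∈ J) (hι : Function.Injective ι)
    (hle : ∀ z, (∀ i, z i ∈ J₂) → z ∈ range ι)
    (hJ : ∀ y, (∀ i, ι (p y) i ∈ J₂) → ∀ i, y i ∈ J) :
    klen k Y = a * klen k (X ⧸ J) + b * klen k J₂ := by
  refine le_antisymm (klen_le_of_cover_of_embedding hp hι h) ?_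
  let P : Submodule k (Fin a → X) := Submodule.pi Set.univ fun _ => J
  let Q : Submodule k (Fin b → X) := Submodule.pi Set.univ fun _ => J₂
  let ψ : P →ₗ[k] Q := (ι ∘ₗ p).restrict fun y hy i _ => h y (fun j => hy j trivial) i
  have hψ : Function.Surjective ψ := by
    intro z
    obtain ⟨y, hy⟩ := hle z.1 fun i => z.2 i trivial
    obtain ⟨x, rfl⟩ := hp y
    exact ⟨⟨x, fun i _ => hJ x (fun i => hy ▸ z.2 i trivial) i⟩, Subtype.ext hy⟩
  have h₁ := klen_eq_ker_add_range ψ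
  have h₂ : klen k (range ψ) = klen k Q :=
    klen_congr ((LinearEquiv.ofEq _ _ (range_eq_top.2 hψ)).trans Submodule.topEquiv)
  have h₃ : klen k (ker p) ≤ klen k (ker ψ) := by
    refine klen_le_of_injective
      (LinearMap.codRestrict (ker ψ) ((ker p).subtype.codRestrict P fun y i _ =>
        hker y.1 y.2 i) fun y => ?_) ?_
    · refine Subtype.ext ?_
      change ι (p y.1) = 0
      rw [show p y.1 = 0 from y.2, map_zero]
    · intro x y hxy
      exact Subtype.ext (congrArg (fun z => z.1.1) hxy)
  have h₄ := klen_eq_add (ker p).injective_subtype hp (exact_subtype_ker_map p)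
  have h₅ := klen_pi_eq (k := k) J a
  have h₆ : klen k Q = b * klen k J₂ := klen_submodule_pi J₂ b
  change _ = klen k P + _ at h₅
  omega

end KLength

section ShortSide

/-- `A` is a free module of rank one over `R` (acting by left or by right multiplication), `J`
is its maximal ideal and `J₂` is annihilated by `J` and contains `J ^ 2`. -/
structure ShortSide (k A R : Type u) [CommRing k] [Ring A] [Algebra k A] [Ring R] [Algebra k R]
    [Module R A] [IsScalarTower k R A] (J J₂ : Submodule k A) : Prop where
  bijective : Function.Bijective fun r : R => r • (1 : A)
  isUnit : ∀ r : R, r • (1 : A) ∉ J → IsUnit r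
  one_notMem : (1 : A) ∉ J
  smul_mem : ∀ (r : R) (a : A), a ∈ J → r • a ∈ J
  smul_mem_of_mem : ∀ (r : R) (a : A), r • (1 : A) ∈ J → r • a ∈ J
  smul_mem₂ : ∀ (r : R) (a : A), a ∈ J₂ → r • a ∈ J₂
  smul_mem₂_of_mem : ∀ (r : R) (a : A), r • (1 : A) ∈ J → a ∈ J → r • a ∈ J₂
  smul_eq_zero : ∀ (r : R) (a : A), r • (1 : A) ∈ J → a ∈ J₂ → r • a = 0
  smul_eq_zero' : ∀ (r : R) (a : A), r • (1 : A) ∈ J₂ → a ∈ J → r • a = 0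
  le : J₂ ≤ J

/-- A module over the `k`-algebra `R` which is finitely generated over `k`. -/
structure KMod (k R : Type u) [CommRing k] [Ring R] [Algebra k R] where
  /-- The underlying type. -/
  carrier : Type u
  [addCommGroup : AddCommGroup carrier]
  [moduleBase : Module k carrier]
  [module : Module R carrier]
  [isScalarTower : IsScalarTower k R carrier]
  [finite : Module.Finite k carrier]

attribute [instance] KMod.addCommGroup KMod.moduleBase KMod.module KMod.isScalarTower KMod.finite

variable {k A R : Type u} [CommRing k] [Ring A] [Algebra k A] [Ring R]
  [Algebra k R] [Module R A] [IsScalarTower k R A]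

/-- Precomposition as a map of `k`-modules. -/
def precomp (k : Type u) [CommRing k] [Algebra k A] [Algebra k R] [IsScalarTower k R A]
    {X Y : Type u} [AddCommGroup X] [Module R X] [AddCommGroup Y] [Module R Y]
    (g : X →ₗ[R] Y) : (Y →ₗ[R] A) →ₗ[k] (X →ₗ[R] A) where
  toFun f := f ∘ₗ g
  map_add' _ _ := rfl
  map_smul' _ _ := rfl

/-- The standard basis vectors of `A ^ n`. -/
abbrev stdVec (A : Type u) [Ring A] {n : ℕ} (i : Fin n) : Fin n → A := Pi.single i 1

/-- The values of a functional at the standard basis vectors. -/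
def evalStd (k A R : Type u) [CommRing k] [Ring A] [Algebra k A] [Ring R]
    [Algebra k R] [Module R A] [IsScalarTower k R A] (n : ℕ) :
    ((Fin n → A) →ₗ[R] A) →ₗ[k] (Fin n → A) where
  toFun f i := f (stdVec A i)
  map_add' _ _ := rfl
  map_smul' _ _ := rfl

namespace ShortSide

variable {J J₂ : Submodule k A} (h : ShortSide k A R J J₂) {n : ℕ}
include h

lemma exists_repr (y : Fin n → A) :
    ∃ r : Fin n → R, (∀ i, r i • (1 : A) = y i) ∧ y = ∑ i, r i • stdVec A i := by
  choose r hr using fun i => h.bijective.2 (y i)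
  refine ⟨r, hr, ?_⟩
  ext j
  simp [Finset.sum_apply, Pi.single_apply, ← hr]

lemma map_mem (f : (Fin n → A) →ₗ[R] A) {y : Fin n → A} (hy : ∀ i, y i ∈ J) : f y ∈ J := by
  obtain ⟨r, hr, e⟩ := h.exists_repr y
  rw [e]
  simp only [map_sum, map_smul]
  exact Submodule.sum_mem _ fun i _ => h.smul_mem_of_mem _ _ (hr i ▸ hy i)

lemma map_mem₂ (f : (Fin n → A) →ₗ[R] A) (hf : ∀ i, f (stdVec A i) ∈ J)
    {y : Fin n → A} (hy : ∀ i, y i ∈ J) : f y ∈ J₂ := by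
  obtain ⟨r, hr, e⟩ := h.exists_repr y
  rw [e]
  simp only [map_sum, map_smul]
  exact Submodule.sum_mem _ fun i _ => h.smul_mem₂_of_mem _ _ (hr i ▸ hy i) (hf i)

lemma map_eq_zero (f : (Fin n → A) →ₗ[R] A) (hf : ∀ i, f (stdVec A i) ∈ J₂)
    {y : Fin n → A} (hy : ∀ i, y i ∈ J) : f y = 0 := by
  obtain ⟨r, hr, e⟩ := h.exists_repr y
  rw [e]
  simp only [map_sum, map_smul]
  exact Finset.sum_eq_zero fun i _ => h.smul_eq_zero _ _ (hr i ▸ hy i) (hf i)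

lemma map_eq_zero' (f : (Fin n → A) →ₗ[R] A) (hf : ∀ i, f (stdVec A i) ∈ J)
    {y : Fin n → A} (hy : ∀ i, y i ∈ J₂) : f y = 0 := by
  obtain ⟨r, hr, e⟩ := h.exists_repr y
  rw [e]
  simp only [map_sum, map_smul]
  exact Finset.sum_eq_zero fun i _ => h.smul_eq_zero' _ _ (hr i ▸ hy i) (hf i)

lemma exists_linearEquiv : ∃ e : R ≃ₗ[R] A, ∀ r, e r = r • (1 : A) :=
  ⟨LinearEquiv.ofBijective (LinearMap.toSpanSingleton R A 1) h.bijective, fun _ => rfl⟩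

lemma free : Module.Free R A :=
  let ⟨e, _⟩ := h.exists_linearEquiv
  Module.Free.of_equiv e

lemma projective_pi : Module.Projective R (Fin n → A) :=
  have := h.free
  inferInstance

lemma evalStd_bijective : Function.Bijective (evalStd k A R n) := by
  obtain ⟨e, he⟩ := h.exists_linearEquiv
  constructor
  · intro f g hfg
    refine LinearMap.ext fun y => ?_
    obtain ⟨r, hr, e⟩ := h.exists_repr y
    rw [e]
    simp only [map_sum, map_smul]
    exact Finset.sum_congr rfl fun i _ => congrArg (r i • ·) (congrFun hfg i)
  · intro v
    have he1 : e.symm 1 = 1 := by rw [LinearEquiv.symm_apply_eq, he, one_smul]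
    refine ⟨∑ i, (LinearMap.toSpanSingleton R A (v i)) ∘ₗ e.symm.toLinearMap ∘ₗ
      LinearMap.proj i, ?_⟩
    ext j
    change (∑ i, (LinearMap.toSpanSingleton R A (v i)) ∘ₗ e.symm.toLinearMap ∘ₗ
      LinearMap.proj i) (stdVec A j) = v j
    rw [LinearMap.sum_apply, Finset.sum_eq_single j]
    · simp [he1]
    · intro i _ hij
      simp [Pi.single_eq_of_ne hij]
    · simp

lemma exists_cover (X : Type u) [AddCommGroup X] [Module R X] [Module.Finite R X] :
    ∃ (n : ℕ) (p : (Fin n → A) →ₗ[R] X), Function.Surjective p ∧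
      ∀ y, p y = 0 → ∀ i, y i ∈ J := by
  classical
  have hex : ∃ (n : ℕ) (p : (Fin n → A) →ₗ[R] X), Function.Surjective p := by
    obtain ⟨n, f, hf⟩ := Module.Finite.exists_fin' R X
    obtain ⟨e, -⟩ := h.exists_linearEquiv
    exact ⟨n, f ∘ₗ (LinearEquiv.piCongrRight fun _ => e.symm).toLinearMap,
      hf.comp (LinearEquiv.surjective _)⟩
  obtain ⟨p, hp⟩ := Nat.find_spec hex
  have hmin := @Nat.find_min _ _ hex
  generalize Nat.find hex = n at p hp hmin
  refine ⟨n, p, hp, fun x hx j => ?_⟩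
  by_contra hj
  obtain _ | n := n
  · exact j.elim0
  refine hmin n.lt_succ_self ?_
  obtain ⟨r, hr, e⟩ := h.exists_repr x
  have hu := h.isUnit (r j) (hr j ▸ hj)
  let ins : (Fin n → A) →ₗ[R] (Fin (n + 1) → A) :=
    { toFun := fun y => j.insertNth 0 y
      map_add' := fun y z => by
        rw [← Fin.insertNth_add, add_zero]
      map_smul' := fun c y => by
        ext i
        refine j.succAboveCases ?_ (fun i => ?_) i <;> simp }
  have hins : ∀ i : Fin n, ins (stdVec A i) = stdVec A (j.succAbove i) := by
    intro i
    ext l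
    refine j.succAboveCases ?_ (fun l => ?_) l
    · simp [ins]
    · simp [ins, Pi.single_apply]
  have hmem : ∀ i, p (stdVec A i) ∈ range (p ∘ₗ ins) := by
    have hne : ∀ i : Fin n, p (stdVec A (j.succAbove i)) ∈ range (p ∘ₗ ins) :=
      fun i => ⟨stdVec A i, by rw [LinearMap.comp_apply, hins]⟩
    refine fun i => j.succAboveCases ?_ hne i
    have h0 : r j • p (stdVec A j) = - ∑ i, r (j.succAbove i) • p (stdVec A (j.succAbove i)) := by
      rw [eq_neg_iff_add_eq_zero, ← Fin.sum_univ_succAbove (fun i => r i • p (stdVec A i)) j,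
        ← hx, e]
      simp only [map_sum, map_smul]
    obtain ⟨c, hc⟩ := hu.exists_left_inv
    have h1 : p (stdVec A j) = c • r j • p (stdVec A j) := by rw [smul_smul, hc, one_smul]
    rw [h1, h0]
    exact Submodule.smul_mem _ _ (Submodule.neg_mem _ (Submodule.sum_mem _ fun i _ =>
      Submodule.smul_mem _ _ (hne i)))
  refine ⟨p ∘ₗ ins, fun z => ?_⟩
  obtain ⟨y, rfl⟩ := hp z
  obtain ⟨r, -, rfl⟩ := h.exists_repr y
  simp only [map_sum, map_smul]
  exact Submodule.sum_mem _ fun i _ => Submodule.smul_mem _ _ (hmem i)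

end ShortSide

end ShortSide

lemma exists_comp_eq_of_ker_le {R X Y Z : Type u} [Ring R] [AddCommGroup X] [Module R X]
    [AddCommGroup Y] [Module R Y] [AddCommGroup Z] [Module R Z] {p : X →ₗ[R] Y}
    (hp : Function.Surjective p) (f : X →ₗ[R] Z) (hf : ∀ x, p x = 0 → f x = 0) :
    ∃ g : Y →ₗ[R] Z, ∀ x, g (p x) = f x := by
  have hle : ker p ≤ ker f := hf
  refine ⟨(ker p).liftQ f hle ∘ₗ (p.quotKerEquivOfSurjective hp).symm.toLinearMap, fun x => ?_⟩
  have : (p.quotKerEquivOfSurjective hp).symm (p x) = Submodule.Quotient.mk x := by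
    rw [LinearEquiv.symm_apply_eq]
    rfl
  change ((ker p).liftQ f hle) ((p.quotKerEquivOfSurjective hp).symm (p x)) = _
  rw [this]
  rfl

namespace ShortSide

variable {k A R : Type u} [CommRing k] [Ring A] [Algebra k A] [Ring R]
  [Algebra k R] [Module R A] [IsScalarTower k R A] {J J₂ : Submodule k A}
  (h : ShortSide k A R J J₂)

/-- The maximal ideal as an `R`-submodule. -/
def maxIdeal : Submodule R A where
  carrier := J
  add_mem' := J.add_mem
  zero_mem' := J.zero_mem
  smul_mem' := h.smul_mem

include h in
lemma exists_cover_kmod (X : KMod k R) :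
    ∃ (n : ℕ) (p : (Fin n → A) →ₗ[R] X.carrier), Function.Surjective p ∧
      ∀ y, p y = 0 → ∀ i, y i ∈ J :=
  have := Module.Finite.of_restrictScalars_finite k R X.carrier
  h.exists_cover X.carrier

/-- The rank of a projective cover. -/
noncomputable def rank (X : KMod k R) : ℕ := (h.exists_cover_kmod X).choose

/-- A projective cover. -/
noncomputable def cover (X : KMod k R) : (Fin (h.rank X) → A) →ₗ[R] X.carrier :=
  (h.exists_cover_kmod X).choose_spec.choose

lemma cover_surjective (X : KMod k R) : Function.Surjective (h.cover X) :=
  (h.exists_cover_kmod X).choose_spec.choose_spec.1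

lemma mem_of_cover_eq_zero (X : KMod k R) {y : Fin (h.rank X) → A} (hy : h.cover X y = 0)
    (i : Fin (h.rank X)) : y i ∈ J :=
  (h.exists_cover_kmod X).choose_spec.choose_spec.2 y hy i

variable [IsArtinianRing k] [Module.Finite k A]

/-- The first syzygy of a module. -/
noncomputable def syz (X : KMod k R) : KMod k R where
  carrier := ker (h.cover X)
  finite := Module.Finite.of_injective ((ker (h.cover X)).subtype.restrictScalars k)
    (ker (h.cover X)).injective_subtype

/-- The inclusion of the first syzygy. -/
noncomputable def incl (X : KMod k R) : (h.syz X).carrier →ₗ[R] (Fin (h.rank X) → A) :=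
  (ker (h.cover X)).subtype

lemma incl_injective (X : KMod k R) : Function.Injective (h.incl X) :=
  (ker (h.cover X)).injective_subtype

lemma exact_incl_cover (X : KMod k R) : Function.Exact (h.incl X) (h.cover X) :=
  exact_subtype_ker_map _

lemma incl_mem (X : KMod k R) (x : (h.syz X).carrier) (i : Fin (h.rank X)) : h.incl X x i ∈ J :=
  h.mem_of_cover_eq_zero X x.2 i

lemma klen_add_klen_syz (X : KMod k R) :
    klen k X.carrier + klen k (h.syz X).carrier = h.rank X * klen k A := by
  rw [← klen_pi, klen_eq_add (f := (h.incl X).restrictScalars k)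
    (g := (h.cover X).restrictScalars k) (h.incl_injective X) (h.cover_surjective X)
    (h.exact_incl_cover X), add_comm]

include h in
lemma finite_functional (n : ℕ) : Module.Finite k ((Fin n → A) →ₗ[R] A) :=
  Module.Finite.of_injective _ h.evalStd_bijective.1

omit [IsArtinianRing k] [Module.Finite k A] in
include h in
lemma klen_functional (n : ℕ) : klen k ((Fin n → A) →ₗ[R] A) = n * klen k A := by
  rw [← klen_pi]
  exact klen_congr (LinearEquiv.ofBijective _ h.evalStd_bijective)

omit [IsArtinianRing k] [Module.Finite k A] in
lemma precomp_cover_injective (X : KMod k R) :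
    Function.Injective (precomp (A := A) k (h.cover X)) := by
  intro f g hfg
  ext x
  obtain ⟨y, rfl⟩ := h.cover_surjective X x
  exact LinearMap.congr_fun hfg y

include h in
lemma finite_dual (X : KMod k R) : Module.Finite k (X.carrier →ₗ[R] A) :=
  have := h.finite_functional (h.rank X)
  Module.Finite.of_injective _ (h.precomp_cover_injective X)

lemma exact_precomp (X : KMod k R) :
    Function.Exact (precomp (A := A) k (h.cover X)) (precomp (A := A) k (h.incl X)) := by
  intro f
  constructor
  · intro hf
    obtain ⟨g, hg⟩ := exists_comp_eq_of_ker_le (h.cover_surjective X) f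
      fun x hx => LinearMap.congr_fun hf ⟨x, hx⟩
    exact ⟨g, LinearMap.ext hg⟩
  · rintro ⟨g, rfl⟩
    refine LinearMap.ext fun x => ?_
    change g (h.cover X x.1) = 0
    rw [show h.cover X x.1 = 0 from x.2, map_zero]

lemma precomp_incl_surjective (X : KMod k R) (hX : ExtVanish R X.carrier A 1) :
    Function.Surjective (precomp (A := A) k (h.incl X)) :=
  fun q => hX.exists_extension (h.incl_injective X) (h.exact_incl_cover X)
    (h.cover_surjective X) q

lemma klen_dual_add_klen_dual_syz (X : KMod k R) (hX : ExtVanish R X.carrier A 1) :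
    klen k (X.carrier →ₗ[R] A) + klen k ((h.syz X).carrier →ₗ[R] A) = h.rank X * klen k A := by
  have := h.finite_functional (h.rank X)
  rw [← h.klen_functional, klen_eq_add (h.precomp_cover_injective X)
    (h.precomp_incl_surjective X hX) (h.exact_precomp X)]

lemma klen_syz_le (X : KMod k R) :
    klen k (h.syz X).carrier ≤ h.rank (h.syz X) * klen k (A ⧸ J) + h.rank X * klen k J₂ :=
  klen_le_of_cover_of_embedding (p := (h.cover (h.syz X)).restrictScalars k)
    (ι := (h.incl X).restrictScalars k) (h.cover_surjective _) (h.incl_injective X)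
    fun _ hy i => h.map_mem₂ (LinearMap.proj i ∘ₗ h.incl X ∘ₗ h.cover (h.syz X))
      (fun _ => h.incl_mem X _ i) hy

lemma klen_dual_syz_le (X : KMod k R) (hX : ExtVanish R X.carrier A 1) :
    klen k ((h.syz X).carrier →ₗ[R] A) ≤
      h.rank X * klen k (A ⧸ J) + h.rank (h.syz X) * klen k J₂ := by
  let e := LinearEquiv.ofBijective _ (h.evalStd_bijective (n := h.rank X))
  refine klen_le_of_cover_of_embedding
    (p := precomp (A := A) k (h.incl X) ∘ₗ e.symm.toLinearMap)
    (ι := evalStd k A R _ ∘ₗ precomp k (h.cover (h.syz X)))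
    ((h.precomp_incl_surjective X hX).comp e.symm.surjective)
    (h.evalStd_bijective.1.comp (h.precomp_cover_injective _)) fun y hy i => ?_
  refine h.map_mem₂ (e.symm y) (fun j => ?_) fun j => h.incl_mem X _ j
  have : e (e.symm y) j ∈ J := by
    rw [e.apply_symm_apply]
    exact hy j
  exact this

/-- Unless the simple module is a direct summand of `Y`, the length of a submodule `Y` of `A ^ b`
between `J₂ ^ b` and `J ^ b` is determined by the rank of its projective cover. -/
lemma klen_eq_of_embedding {Y : KMod k R} {a b m : ℕ}
    {p : (Fin a → A) →ₗ[R] Y.carrier} (hp : Function.Surjective p)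
    (hker : ∀ y, p y = 0 → ∀ i, y i ∈ J) {ι : Y.carrier →ₗ[R] (Fin b → A)}
    (hι : Function.Injective ι) (hrange : ∀ y i, ι y i ∈ J)
    (hle : ∀ z, (∀ i, z i ∈ J₂) → z ∈ range ι)
    (hY : ExtVanish R Y.carrier A m) (hS : ¬ ExtVanish R (A ⧸ h.maxIdeal) A m) :
    klen k Y.carrier = a * klen k (A ⧸ J) + b * klen k J₂ := by
  refine klen_eq_of_cover_of_embedding (p := p.restrictScalars k)
    (ι := ι.restrictScalars k) hp
    (fun _ hy i => h.map_mem₂ (LinearMap.proj i ∘ₗ ι ∘ₗ p) (fun _ => hrange _ i) hy) hker hι hle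
    fun y hy j => ?_
  by_contra hj
  refine hS ?_
  obtain ⟨e, he⟩ := h.exists_linearEquiv
  have he' : ∀ a, e.symm a • (1 : A) = a := fun a => by rw [← he, e.apply_symm_apply]
  obtain ⟨r, hr⟩ := h.bijective.2 (y j)
  have hr' : r • (1 : A) = y j := hr
  obtain ⟨c, hc⟩ := (h.isUnit r (hr'.symm ▸ hj)).exists_right_inv
  let α : A ⧸ h.maxIdeal →ₗ[R] Y.carrier :=
    h.maxIdeal.liftQ (LinearMap.toSpanSingleton R Y.carrier (p y) ∘ₗ e.symm.toLinearMap) <| by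
      intro a ha
      have ha' : a ∈ J := ha
      refine hι ?_
      rw [map_zero]
      ext i
      change ι (e.symm a • p y) i = 0
      rw [map_smul]
      exact h.smul_eq_zero _ _ ((he' a).symm ▸ ha') (hy i)
  let β₀ : (Fin a → A) →ₗ[R] A ⧸ h.maxIdeal := h.maxIdeal.mkQ ∘ₗ
    LinearMap.toSpanSingleton R A (c • (1 : A)) ∘ₗ e.symm.toLinearMap ∘ₗ LinearMap.proj j
  obtain ⟨β, hβ⟩ := exists_comp_eq_of_ker_le hp β₀ fun x hx =>
    (Submodule.Quotient.mk_eq_zero _).2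
      (h.smul_mem_of_mem (e.symm (x j)) _ ((he' _).symm ▸ hker x hx j))
  refine hY.of_retract α β ?_
  ext a
  change β (e.symm a • p y) = h.maxIdeal.mkQ a
  rw [map_smul, hβ, ← map_smul]
  change h.maxIdeal.mkQ (e.symm (e.symm a • y j) • c • (1 : A)) = _
  rw [← hr', smul_smul (e.symm a), ← he, e.symm_apply_apply, smul_smul, mul_assoc, hc, mul_one,
    he']

end ShortSide

lemma isScalarTower_dl (k A X : Type u) [CommRing k] [Ring A] [Algebra k A] [AddCommGroup X]
    [Module A X] : IsScalarTower k Aᵐᵒᵖ (Dl A X) where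
  smul_assoc c a f := by
    ext x
    exact smul_assoc c a (f x)

lemma isScalarTower_dr (k A X : Type u) [CommRing k] [Ring A] [Algebra k A] [AddCommGroup X]
    [Module Aᵐᵒᵖ X] : IsScalarTower k A (Dr A X) where
  smul_assoc c a f := by
    ext x
    exact smul_assoc c a (f x)

namespace ShortSide

section Length

variable {k A R : Type u} [CommRing k] [Ring A] [Algebra k A] [Ring R]
  [Algebra k R] [Module R A] [IsScalarTower k R A] {J J₂ : Submodule k A}
  (h : ShortSide k A R J J₂) [IsArtinianRing k] [Module.Finite k A]

include h

lemma klen_residue_pos : 0 < klen k (A ⧸ J) := by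
  rw [Nat.pos_iff_ne_zero, Ne, klen_eq_zero_iff, Submodule.Quotient.subsingleton_iff]
  exact fun hJ => h.one_notMem (hJ ▸ trivial)

lemma klen_le_or_add_le (U V : Submodule k A) (hVU : V ≤ U)
    (hU : ∀ (r : R), ∀ a ∈ U, r • a ∈ U) (hV : ∀ (r : R), ∀ a ∈ V, r • a ∈ V) :
    klen k U = klen k V ∨ klen k V + klen k (A ⧸ J) ≤ klen k U := by
  by_cases hUV : U ≤ V
  · exact Or.inl (by rw [le_antisymm hUV hVU])
  right
  obtain ⟨x, hxU, hxV⟩ := Set.not_subset.1 hUV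
  obtain ⟨e, he⟩ := h.exists_linearEquiv
  have he' : ∀ a, e.symm a • (1 : A) = a := fun a => by rw [← he, e.apply_symm_apply]
  let φ : A →ₗ[k] A ⧸ V := V.mkQ ∘ₗ
    ((LinearMap.toSpanSingleton R A x) ∘ₗ e.symm.toLinearMap).restrictScalars k
  let g : U →ₗ[k] A ⧸ V := V.mkQ ∘ₗ U.subtype
  have h₁ := klen_eq_ker_add_range φ
  have h₂ := klen_eq_ker_add_range g
  have h₃ : klen k V ≤ klen k (ker g) :=
    klen_le_of_injective ((Submodule.inclusion hVU).codRestrict (ker g) fun v =>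
      (Submodule.Quotient.mk_eq_zero V).2 v.2) fun v w hvw =>
        Subtype.ext (congrArg (fun z : ker g => (z.1.1 : A)) hvw)
  have h₄ : klen k (range φ) ≤ klen k (range g) := by
    refine klen_le_of_le ?_
    rintro _ ⟨a, rfl⟩
    exact ⟨⟨e.symm a • x, hU _ _ hxU⟩, rfl⟩
  have h₅ : klen k (ker φ) ≤ klen k J := by
    refine klen_le_of_le fun a ha => ?_
    by_contra haJ
    have ha' : e.symm a • x ∈ V := (Submodule.Quotient.mk_eq_zero V).1 ha
    obtain ⟨c, hc⟩ := (h.isUnit (e.symm a) (by rwa [he'])).exists_left_inv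
    refine hxV ?_
    have := hV c _ ha'
    rwa [smul_smul, hc, one_smul] at this
  have h₆ := klen_eq_quotient_add J
  omega

lemma exists_klen_eq : ∃ E, klen k A = klen k (A ⧸ J) + E + klen k J₂ ∧
    (E = 0 ∨ klen k (A ⧸ J) ≤ E) ∧ (klen k J₂ = 0 ∨ klen k (A ⧸ J) ≤ klen k J₂) := by
  have h₁ := klen_eq_quotient_add J
  have h₂ := h.klen_le_or_add_le J J₂ h.le h.smul_mem h.smul_mem₂
  have h₃ := h.klen_le_or_add_le J₂ ⊥ bot_le h.smul_mem₂ (by simp)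
  have h₄ : klen k (⊥ : Submodule k A) = 0 := klen_eq_zero_iff.2 inferInstance
  have h₅ := klen_le_of_le h.le
  exact ⟨klen k J - klen k J₂, by omega, by omega, by omega⟩

omit [IsArtinianRing k] [Module.Finite k A] in
lemma nonempty_residue_equiv (T : Type u) [AddCommGroup T] [Module R T] [IsSimpleModule R T] :
    Nonempty (T ≃ₗ[R] A ⧸ h.maxIdeal) := by
  have := IsSimpleModule.nontrivial R T
  obtain ⟨x, hx⟩ := exists_ne (0 : T)
  obtain ⟨e, he⟩ := h.exists_linearEquiv
  have he' : ∀ a, e.symm a • (1 : A) = a := fun a => by rw [← he, e.apply_symm_apply]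
  let φ : A →ₗ[R] T := LinearMap.toSpanSingleton R T x ∘ₗ e.symm.toLinearMap
  have hφ : Function.Surjective φ :=
    (IsSimpleModule.toSpanSingleton_surjective R hx).comp e.symm.surjective
  have hle : ker φ ≤ h.maxIdeal := by
    intro a ha
    by_contra haJ
    have ha' : e.symm a • x = 0 := ha
    obtain ⟨c, hc⟩ := (h.isUnit (e.symm a) (by rw [he']; exact haJ)).exists_left_inv
    refine hx ?_
    rw [← one_smul R x, ← hc, mul_smul, ha', smul_zero]
  have hco : IsCoatom (ker φ) := by
    rw [← isSimpleModule_iff_isCoatom]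
    exact IsSimpleModule.congr (φ.quotKerEquivOfSurjective hφ)
  have heq : ker φ = h.maxIdeal := by
    rcases hco.le_iff.1 hle with h' | h'
    · exact absurd (show (1 : A) ∈ h.maxIdeal from h' ▸ trivial) h.one_notMem
    · exact h'.symm
  exact ⟨(φ.quotKerEquivOfSurjective hφ).symm.trans (Submodule.quotEquivOfEq _ _ heq)⟩

omit [Module.Finite k A] in
lemma extVanish_of_residue {n : ℕ} (hS : ExtVanish R (A ⧸ h.maxIdeal) A n) (X : KMod k R) :
    ExtVanish R X.carrier A n := by
  refine ExtVanish.of_isFiniteLength (fun T _ _ _ => ?_) ?_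
  · obtain ⟨e⟩ := h.nonempty_residue_equiv T
    exact hS.of_linearEquiv e
  · exact isFiniteLength_iff_isNoetherian_isArtinian.2
      ⟨isNoetherian_of_tower k inferInstance, isArtinian_of_tower k inferInstance⟩

lemma extVanish_syz {X : KMod k R} (hX : ∀ n, ExtVanish R X.carrier A (n + 1)) (n : ℕ) :
    ExtVanish R (h.syz X).carrier A (n + 1) :=
  have := h.projective_pi (n := h.rank X)
  (hX (n + 1)).syzygy (h.incl_injective X) (h.exact_incl_cover X) (h.cover_surjective X)

omit [IsArtinianRing k] [Module.Finite k A] in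
/-- A module embedded into the radical of a free module is annihilated by `J₂`. -/
lemma cover_eq_zero {V : KMod k R} {b : ℕ} {ι : V.carrier →ₗ[R] (Fin b → A)}
    (hι : Function.Injective ι) (hrange : ∀ y i, ι y i ∈ J) {z : Fin (h.rank V) → A}
    (hz : ∀ i, z i ∈ J₂) : h.cover V z = 0 := by
  refine hι ?_
  rw [map_zero]
  ext i
  exact h.map_eq_zero' (LinearMap.proj i ∘ₗ ι ∘ₗ h.cover V) (fun _ => hrange _ i) hz

lemma klen_syz_eq {V : KMod k R} {b m : ℕ} {ι : V.carrier →ₗ[R] (Fin b → A)}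
    (hι : Function.Injective ι) (hrange : ∀ y i, ι y i ∈ J)
    (hV : ExtVanish R (h.syz V).carrier A m) (hS : ¬ ExtVanish R (A ⧸ h.maxIdeal) A m) :
    klen k (h.syz V).carrier =
      h.rank (h.syz V) * klen k (A ⧸ J) + h.rank V * klen k J₂ :=
  h.klen_eq_of_embedding (h.cover_surjective _) (fun _ hy => h.mem_of_cover_eq_zero _ hy)
    (h.incl_injective V) (h.incl_mem V)
    (fun z hz => ⟨⟨z, h.cover_eq_zero hι hrange hz⟩, rfl⟩) hV hS

end Length

section Dual

variable {k A : Type u} [CommRing k] [IsArtinianRing k] [Ring A] [Algebra k A]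
  [Module.Finite k A] {J J₂ : Submodule k A} (h : ShortSide k A A J J₂)
  (h' : ShortSide k A Aᵐᵒᵖ J J₂)

/-- The dual of a left module. -/
def dualL (X : KMod k A) : KMod k Aᵐᵒᵖ where
  carrier := Dl A X.carrier
  isScalarTower := isScalarTower_dl k A X.carrier
  finite := h.finite_dual X

/-- The dual of a right module. -/
def dualR (X : KMod k Aᵐᵒᵖ) : KMod k A where
  carrier := Dr A X.carrier
  isScalarTower := isScalarTower_dr k A X.carrier
  finite := h'.finite_dual X

/-- The values of a functional at the standard basis vectors, as an isomorphism. -/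
noncomputable def evalStdEquiv (n : ℕ) : Dl A (Fin n → A) ≃ₗ[Aᵐᵒᵖ] (Fin n → A) :=
  LinearEquiv.ofBijective
    { toFun := fun f i => f (stdVec A i)
      map_add' := fun _ _ => rfl
      map_smul' := fun _ _ => rfl } h.evalStd_bijective

/-- The dual of a projective cover. -/
noncomputable def dualIncl (X : KMod k A) :
    (h.dualL X).carrier →ₗ[Aᵐᵒᵖ] (Fin (h.rank X) → A) :=
  (h.evalStdEquiv _).toLinearMap ∘ₗ dualMapL (h.cover X)

/-- The dual of the inclusion of the first syzygy. -/
noncomputable def dualCover (X : KMod k A) :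
    (Fin (h.rank X) → A) →ₗ[Aᵐᵒᵖ] (h.dualL (h.syz X)).carrier :=
  dualMapL (h.incl X) ∘ₗ (h.evalStdEquiv _).symm.toLinearMap

lemma dualIncl_injective (X : KMod k A) : Function.Injective (h.dualIncl X) :=
  (h.evalStdEquiv _).injective.comp (h.precomp_cover_injective X)

lemma dualCover_surjective (X : KMod k A) (hX : ExtVanish A X.carrier A 1) :
    Function.Surjective (h.dualCover X) :=
  Function.Surjective.comp (g := dualMapL (h.incl X)) (h.precomp_incl_surjective X hX)
    (h.evalStdEquiv _).symm.surjective

lemma exact_dualIncl_dualCover (X : KMod k A) :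
    Function.Exact (h.dualIncl X) (h.dualCover X) := by
  intro v
  obtain ⟨f, rfl⟩ := (h.evalStdEquiv _).surjective v
  change dualMapL (h.incl X) ((h.evalStdEquiv _).symm (h.evalStdEquiv _ f)) = 0 ↔
    ∃ g, h.evalStdEquiv _ (dualMapL (h.cover X) g) = h.evalStdEquiv _ f
  simp only [LinearEquiv.symm_apply_apply, (h.evalStdEquiv _).injective.eq_iff]
  exact h.exact_precomp X f

lemma mem_range_dualIncl (X : KMod k A) {v : Fin (h.rank X) → A} (hv : ∀ i, v i ∈ J₂) :
    v ∈ range (h.dualIncl X) := by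
  obtain ⟨f, rfl⟩ := (h.evalStdEquiv _).surjective v
  obtain ⟨g, hg⟩ := exists_comp_eq_of_ker_le (h.cover_surjective X) f
    fun x hx => h.map_eq_zero f hv (fun i => h.mem_of_cover_eq_zero X hx i)
  exact ⟨g, congrArg (h.evalStdEquiv _) (show g ∘ₗ h.cover X = f from LinearMap.ext hg)⟩

lemma dualIncl_mem {X : KMod k A} (hX : ∀ (f : Dl A X.carrier) x, f x ∈ J)
    (f : (h.dualL X).carrier) (i : Fin (h.rank X)) : h.dualIncl X f i ∈ J :=
  hX f _

lemma mem_of_dualCover_eq_zero {X : KMod k A} (hX : ∀ (f : Dl A X.carrier) x, f x ∈ J)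
    (v : Fin (h.rank X) → A) (hv : h.dualCover X v = 0) (i : Fin (h.rank X)) : v i ∈ J := by
  obtain ⟨f, rfl⟩ := (h.exact_dualIncl_dualCover X v).1 hv
  exact h.dualIncl_mem hX f i

lemma functional_syz_mem {X : KMod k A} (hX : ExtVanish A X.carrier A 1)
    (f : Dl A (h.syz X).carrier) (x : (h.syz X).carrier) : f x ∈ J := by
  obtain ⟨g, rfl⟩ := h.precomp_incl_surjective X hX f
  exact h.map_mem g (h.incl_mem X x)

lemma klen_dualL_syz_eq {X : KMod k A} {m : ℕ} (hX : ∀ n, ExtVanish A X.carrier A (n + 1))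
    (hJ : ∀ (f : Dl A X.carrier) x, f x ∈ J)
    (hZ : ExtVanish Aᵐᵒᵖ (h.dualL (h.syz X)).carrier A m)
    (hS : ¬ ExtVanish Aᵐᵒᵖ (A ⧸ h'.maxIdeal) A m) :
    klen k (h.dualL (h.syz X)).carrier =
      h.rank X * klen k (A ⧸ J) + h.rank (h.syz X) * klen k J₂ :=
  h'.klen_eq_of_embedding (h.dualCover_surjective X (hX 0)) (h.mem_of_dualCover_eq_zero hJ)
    (h.dualIncl_injective _) (h.dualIncl_mem (h.functional_syz_mem (hX 0)))
    (fun _ => h.mem_range_dualIncl _) hZ hS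

lemma klen_dualL_eq {X : KMod k A} {m : ℕ}
    (hJ : ∀ (f : Dl A X.carrier) x, f x ∈ J)
    (hZ : ExtVanish Aᵐᵒᵖ (h.dualL X).carrier A m)
    (hS : ¬ ExtVanish Aᵐᵒᵖ (A ⧸ h'.maxIdeal) A m) :
    klen k (h.dualL X).carrier =
      h'.rank (h.dualL X) * klen k (A ⧸ J) + h.rank X * klen k J₂ :=
  h'.klen_eq_of_embedding (h'.cover_surjective _) (fun _ hy => h'.mem_of_cover_eq_zero _ hy)
    (h.dualIncl_injective _) (h.dualIncl_mem hJ)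
    (fun _ => h.mem_range_dualIncl _) hZ hS

end Dual

end ShortSide

namespace ShortSide

/-- The iterated syzygies of a module. -/
noncomputable def syzIter {k A R : Type u} [CommRing k] [Ring A] [Algebra k A] [Ring R]
    [Algebra k R] [Module R A] [IsScalarTower k R A] {J J₂ : Submodule k A}
    (h : ShortSide k A R J J₂) [IsArtinianRing k] [Module.Finite k A] (X : KMod k R) :
    ℕ → KMod k R
  | 0 => X
  | n + 1 => h.syz (h.syzIter X n)

lemma extVanish_syzIter {k A R : Type u} [CommRing k] [Ring A] [Algebra k A] [Ring R]
    [Algebra k R] [Module R A] [IsScalarTower k R A] {J J₂ : Submodule k A}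
    (h : ShortSide k A R J J₂) [IsArtinianRing k] [Module.Finite k A] {X : KMod k R}
    (hX : ∀ n, ExtVanish R X.carrier A (n + 1)) (i n : ℕ) :
    ExtVanish R (h.syzIter X i).carrier A (n + 1) := by
  induction i generalizing n with
  | zero => exact hX n
  | succ i ih => exact h.extVanish_syz ih n

variable {k A : Type u} [CommRing k] [IsArtinianRing k] [Ring A] [Algebra k A]
  [Module.Finite k A] {J J₂ : Submodule k A} (h : ShortSide k A A J J₂)
  (h' : ShortSide k A Aᵐᵒᵖ J J₂)

lemma functional_syzIter_mem {X : KMod k A} (hX : ∀ n, ExtVanish A X.carrier A (n + 1))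
    (hJ : ∀ (f : Dl A X.carrier) x, f x ∈ J) (i : ℕ) :
    ∀ (f : Dl A (h.syzIter X i).carrier) x, f x ∈ J := by
  cases i with
  | zero => exact hJ
  | succ i => exact h.functional_syz_mem (h.extVanish_syzIter hX i 0)

include h' in
lemma extVanish_dualL_syzIter {X : KMod k A} (hX : ∀ n, ExtVanish A X.carrier A (n + 1))
    (hN : ExtVanish Aᵐᵒᵖ (h.dualL X).carrier A 1) (i : ℕ) :
    ExtVanish Aᵐᵒᵖ (h.dualL (h.syzIter X i)).carrier A (i + 1) := by
  induction i with
  | zero => exact hN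
  | succ i ih =>
    have := h'.projective_pi (n := h.rank (h.syzIter X i))
    exact ih.cosyzygy (h.dualIncl_injective _) (h.exact_dualIncl_dualCover _)
      (h.dualCover_surjective _ (h.extVanish_syzIter hX i 0))

/-- The equality of lengths if sufficiently many extensions of the simple module exist. -/
lemma klen_eq_klen_bidual_of_not_extVanish {X : KMod k A}
    (hX : ∀ n, ExtVanish A X.carrier A (n + 1))
    (hN : ∀ n, ExtVanish Aᵐᵒᵖ (h.dualL X).carrier A (n + 1))
    (hJ : ∀ (f : Dl A X.carrier) x, f x ∈ J)
    (hS : ∀ n, ¬ ExtVanish Aᵐᵒᵖ (A ⧸ h'.maxIdeal) A (n + 1)) :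
    klen k X.carrier = klen k (h'.dualR (h.dualL X)).carrier := by
  obtain ⟨E, hA, hE, hB⟩ := h.exists_klen_eq
  have hJi := h.functional_syzIter_mem hX hJ
  refine length_eq_of_recursions (s := klen k (A ⧸ J)) (E := E) (B := klen k J₂)
    (t := fun i => h.rank (h.syzIter X i))
    (q := fun i => h'.rank (h'.syzIter (h.dualL X) i))
    (m := fun i => klen k (h.syzIter X i).carrier)
    (z := fun i => klen k (h.dualL (h.syzIter X i)).carrier)
    (n := fun i => klen k (h'.syzIter (h.dualL X) i).carrier)
    (w := fun i => klen k (h'.dualR (h'.syzIter (h.dualL X) i)).carrier)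
    h.klen_residue_pos hE hB ?_ ?_ ?_ ?_ rfl ?_ ?_ ?_ ?_ ?_
  · exact fun i => hA ▸ h.klen_add_klen_syz (h.syzIter X i)
  · exact fun i => hA ▸ h.klen_dual_add_klen_dual_syz (h.syzIter X i)
      (h.extVanish_syzIter hX i 0)
  · exact fun i => hA ▸ h'.klen_add_klen_syz (h'.syzIter (h.dualL X) i)
  · exact fun i => hA ▸ h'.klen_dual_add_klen_dual_syz (h'.syzIter (h.dualL X) i)
      (h'.extVanish_syzIter hN i 0)
  · exact fun i => h.klen_syz_le (h.syzIter X i)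
  · exact fun i => h.klen_dualL_syz_eq h' (h.extVanish_syzIter hX i) (hJi i)
      (h.extVanish_dualL_syzIter h' hX (hN 0) (i + 1)) (hS _)
  · intro i
    cases i with
    | zero =>
      exact h'.klen_syz_eq (h.dualIncl_injective X) (h.dualIncl_mem hJ)
        (h'.extVanish_syzIter hN 1 0) (hS 0)
    | succ i =>
      exact h'.klen_syz_eq (h'.incl_injective _) (h'.incl_mem _)
        (h'.extVanish_syzIter hN (i + 2) 0) (hS 0)
  · exact h.klen_dualL_eq h' hJ (hN 0) (hS 0)
  · exact fun i => h'.klen_dual_syz_le (h'.syzIter (h.dualL X) i)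
      (h'.extVanish_syzIter hN i 0)

include h' in
lemma evalL_surjective {X : KMod k A} (hX : ExtVanish A X.carrier A 1)
    (hZ : ExtVanish Aᵐᵒᵖ (h.dualL (h.syz X)).carrier A 1) :
    Function.Surjective (evalL A X.carrier) := by
  intro ψ
  obtain ⟨ψ', hψ'⟩ := hZ.exists_extension (h.dualIncl_injective X) (h.exact_dualIncl_dualCover X)
    (h.dualCover_surjective X hX) ψ
  refine ⟨h.cover X fun i => ψ' (stdVec A i), ?_⟩
  ext f
  have h₁ : ψ f = ψ' (h.dualIncl X f) := (LinearMap.congr_fun hψ' f).symm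
  rw [h₁]
  change f (h.cover X _) = _
  obtain ⟨r, hr, e⟩ := h'.exists_repr (h.dualIncl X f)
  obtain ⟨l, hl, e'⟩ := h.exists_repr fun i => ψ' (stdVec A i)
  rw [e, e']
  simp only [map_sum, map_smul]
  refine Finset.sum_congr rfl fun i _ => ?_
  have h₂ : l i = ψ' (stdVec A i) := by simpa using hl i
  have h₃ : (r i).unop = f (h.cover X (stdVec A i)) :=
    (by simpa using hr i : (r i).unop = h.dualIncl X f i)
  rw [h₂, ← h₃]
  rfl

lemma evalL_injective {X : KMod k A} (hX : ExtVanish A X.carrier A 1)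
    (hs : Function.Surjective (evalL A (h.syz X).carrier)) :
    Function.Injective (evalL A X.carrier) := by
  rw [← ker_eq_bot, eq_bot_iff]
  intro x hx
  obtain ⟨u, rfl⟩ := h.cover_surjective X x
  have hx' : ∀ f : Dl A X.carrier, f (h.cover X u) = 0 := fun f => LinearMap.congr_fun hx f
  obtain ⟨χ, hχ⟩ := exists_comp_eq_of_ker_le (h.dualCover_surjective X hX)
    (evalL A (Fin (h.rank X) → A) u ∘ₗ (h.evalStdEquiv _).symm.toLinearMap) fun v hv => by
      obtain ⟨f, rfl⟩ := (h.exact_dualIncl_dualCover X v).1 hv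
      change ((h.evalStdEquiv _).symm (h.evalStdEquiv _ (dualMapL (h.cover X) f))) u = 0
      rw [LinearEquiv.symm_apply_apply]
      exact hx' f
  obtain ⟨y, rfl⟩ := hs χ
  have hf : ∀ f : Dl A (Fin (h.rank X) → A), f (h.incl X y) = f u := by
    intro f
    have := hχ (h.evalStdEquiv _ f)
    change (h.evalStdEquiv _).symm (h.evalStdEquiv _ f) (h.incl X y) =
      (h.evalStdEquiv _).symm (h.evalStdEquiv _ f) u at this
    rwa [LinearEquiv.symm_apply_apply] at this
  have hu : h.incl X y = u := funext fun i => hf (LinearMap.proj i)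
  rw [← hu]
  exact (h.exact_incl_cover X _).2 ⟨y, rfl⟩

include h in
/-- If the simple module has a vanishing extension group, then `X` is reflexive. -/
lemma evalL_bijective_of_extVanish {X : KMod k A} (hX : ∀ n, ExtVanish A X.carrier A (n + 1))
    {n : ℕ} (hS : ExtVanish Aᵐᵒᵖ (A ⧸ h'.maxIdeal) A (n + 1)) :
    Function.Bijective (evalL A X.carrier) := by
  have key : ∀ n, (∀ i, ExtVanish Aᵐᵒᵖ (h.dualL (h.syzIter X i)).carrier A (n + 1)) →
      ∀ i, ExtVanish Aᵐᵒᵖ (h.dualL (h.syzIter X i)).carrier A 1 := by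
    intro n
    induction n with
    | zero => exact fun h0 => h0
    | succ n ih =>
      refine fun h0 => ih fun i => ?_
      have := h'.projective_pi (n := h.rank (h.syzIter X i))
      exact (h0 (i + 1)).syzygy (h.dualIncl_injective _) (h.exact_dualIncl_dualCover _)
        (h.dualCover_surjective _ (h.extVanish_syzIter hX i 0))
  have hZ := key n fun i => h'.extVanish_of_residue hS _
  exact ⟨h.evalL_injective (hX 0)
    (h.evalL_surjective h' (h.extVanish_syzIter hX 1 0) (hZ 2)),
    h.evalL_surjective h' (hX 0) (hZ 1)⟩

/-- The evaluation map as a map of `k`-modules. -/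
def evalBase (X : KMod k A) : X.carrier →ₗ[k] (h'.dualR (h.dualL X)).carrier where
  toFun x := evalL A X.carrier x
  map_add' := map_add _
  map_smul' c x := by
    refine LinearMap.ext fun f => ?_
    exact map_smul_of_tower (f : X.carrier →ₗ[A] A) c x

lemma klen_eq_klen_bidual_of_functional_mem {X : KMod k A}
    (hX : ∀ n, ExtVanish A X.carrier A (n + 1))
    (hN : ∀ n, ExtVanish Aᵐᵒᵖ (h.dualL X).carrier A (n + 1))
    (hJ : ∀ (f : Dl A X.carrier) x, f x ∈ J) :
    klen k X.carrier = klen k (h'.dualR (h.dualL X)).carrier := by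
  by_cases hS : ∃ n, ExtVanish Aᵐᵒᵖ (A ⧸ h'.maxIdeal) A (n + 1)
  · obtain ⟨n, hn⟩ := hS
    exact klen_congr (LinearEquiv.ofBijective (h.evalBase h' X)
      (h.evalL_bijective_of_extVanish h' hX hn))
  · exact h.klen_eq_klen_bidual_of_not_extVanish h' hX hN hJ (not_exists.1 hS)

omit [Module.Finite k A] in
lemma klen_bidual_eq_add {X X' : Type u} [AddCommGroup X] [Module A X] [AddCommGroup X']
    [Module A X'] [Module.Finite k (Dr A (Dl A X))] {i : X' →ₗ[A] X} {π : X →ₗ[A] X'}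
    (hdual : dualMapL i ∘ₗ dualMapL π = LinearMap.id) {f : Dl A X} {x : X} (hx : f x = 1)
    (hif : dualMapL i f = 0)
    (hsplit : ∀ g : Dl A X, g = dualMapL π (dualMapL i g) + MulOpposite.op (g x) • f) :
    klen k (Dr A (Dl A X)) = klen k (Dr A (Dl A X')) + klen k A := by
  let ev : Dr A (Dl A X) →ₗ[k] A :=
    { toFun := fun Ψ => Ψ f
      map_add' := fun _ _ => rfl
      map_smul' := fun _ _ => rfl }
  refine klen_eq_add (f := precomp (A := A) (R := Aᵐᵒᵖ) k (dualMapL i)) (g := ev) ?_ ?_ ?_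
  · intro ψ χ hψχ
    refine LinearMap.ext fun g => ?_
    have := LinearMap.congr_fun hψχ (dualMapL π g)
    change ψ ((dualMapL i ∘ₗ dualMapL π) g) = χ ((dualMapL i ∘ₗ dualMapL π) g) at this
    rwa [hdual] at this
  · refine fun a => ⟨evalL A X (a • x), ?_⟩
    change f (a • x) = a
    rw [map_smul, hx, smul_eq_mul, mul_one]
  · intro Ψ
    constructor
    · intro hΨ
      have hΨ' : Ψ f = 0 := hΨ
      refine ⟨precomp (A := A) (R := Aᵐᵒᵖ) k (dualMapL π) Ψ, LinearMap.ext fun g => ?_⟩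
      change Ψ (dualMapL π (dualMapL i g)) = Ψ g
      conv_rhs => rw [hsplit g]
      rw [map_add, map_smul, hΨ', smul_zero, add_zero]
    · rintro ⟨ψ, rfl⟩
      change ψ (dualMapL i f) = 0
      rw [hif, map_zero]

/-- A module and its bidual have the same length over the base ring. -/
theorem klen_eq_klen_bidual (X : KMod k A)
    (hX : ∀ n, ExtVanish A X.carrier A (n + 1))
    (hN : ∀ n, ExtVanish Aᵐᵒᵖ (h.dualL X).carrier A (n + 1)) :
    klen k X.carrier = klen k (h'.dualR (h.dualL X)).carrier := by
  induction hn : klen k X.carrier using Nat.strong_induction_on generalizing X with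
  | _ n ih =>
  rw [← hn]
  by_cases hJ : ∀ (f : Dl A X.carrier) x, f x ∈ J
  · exact h.klen_eq_klen_bidual_of_functional_mem h' hX hN hJ
  push Not at hJ
  obtain ⟨f, x₀, hx₀⟩ := hJ
  obtain ⟨c, hc⟩ := (h.isUnit (f x₀) (by simpa using hx₀)).exists_left_inv
  obtain ⟨x, hx⟩ : ∃ x, f x = 1 := ⟨c • x₀, by rw [map_smul, smul_eq_mul, hc]⟩
  have hf : Function.Surjective f := fun a => ⟨a • x, by rw [map_smul, hx, smul_eq_mul, mul_one]⟩
  let X' : KMod k A :=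
    { carrier := ker f
      finite := Module.Finite.of_injective ((ker f).subtype.restrictScalars k)
        (ker f).injective_subtype }
  let i : X'.carrier →ₗ[A] X.carrier := (ker f).subtype
  let π : X.carrier →ₗ[A] X'.carrier :=
    (LinearMap.id - LinearMap.toSpanSingleton A X.carrier x ∘ₗ f).codRestrict (ker f) fun y => by
      simp [hx]
  have hiπ : ∀ y, i (π y) = y - f y • x := fun y => rfl
  have hπi : π ∘ₗ i = LinearMap.id := by
    ext y
    change i (π (i y)) = i y
    rw [hiπ, show f (i y) = 0 from y.2, zero_smul, sub_zero]
  have hdual : dualMapL i ∘ₗ dualMapL π = LinearMap.id := by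
    refine LinearMap.ext fun g => ?_
    change (g ∘ₗ π) ∘ₗ i = g
    rw [LinearMap.comp_assoc, hπi, LinearMap.comp_id]
  have hsplit : ∀ g : Dl A X.carrier,
      g = dualMapL π (dualMapL i g) + MulOpposite.op (g x) • f := by
    intro g
    ext y
    change g y = g (i (π y)) + f y * g x
    rw [hiπ, map_sub, map_smul, smul_eq_mul, sub_add_cancel]
  have h₁ : klen k X.carrier = klen k X'.carrier + klen k A :=
    klen_eq_add (f := i.restrictScalars k) (g := f.restrictScalars k)
      (ker f).injective_subtype hf (exact_subtype_ker_map f)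
  have h₂ : klen k (h'.dualR (h.dualL X)).carrier =
      klen k (h'.dualR (h.dualL X')).carrier + klen k A :=
    have : Module.Finite k (Dr A (Dl A X.carrier)) := (h'.dualR (h.dualL X)).finite
    klen_bidual_eq_add hdual hx (LinearMap.ext fun y => y.2) hsplit
  have hpos := h.klen_residue_pos
  have hA := klen_eq_quotient_add J
  have h₃ := ih (klen k X'.carrier) (by omega) X' (fun n => (hX n).of_retract i π hπi)
    (fun n => (hN n).of_retract (dualMapL π) (dualMapL i) hdual) rfl
  omega

end ShortSide

section Local

variable {k A : Type u} [CommRing k] [Ring A] [Algebra k A] [IsLocalRing A]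
  [IsDedekindFiniteMonoid A]

variable (k A) in
/-- The nonunits of a local algebra. -/
def nonunitsSubmodule : Submodule k A where
  carrier := nonunits A
  zero_mem' := not_isUnit_zero
  add_mem' {a b} ha hb := by
    rintro ⟨u, hu⟩
    have : (↑u⁻¹ * a) + (↑u⁻¹ * b) = 1 := by rw [← mul_add, ← hu, Units.inv_mul]
    rcases IsLocalRing.isUnit_or_isUnit_of_add_one this with h | h
    · exact ha ((Units.isUnit_units_mul _ _).1 h)
    · exact hb ((Units.isUnit_units_mul _ _).1 h)
  smul_mem' c a ha := by
    change ¬ IsUnit (c • a)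
    rw [Algebra.smul_def]
    exact fun h => ha (isUnit_of_mul_isUnit_right h)

lemma mul_mem_nonunitsSubmodule_left (r : A) {a : A} (ha : a ∈ nonunitsSubmodule k A) :
    r * a ∈ nonunitsSubmodule k A :=
  fun h => ha (isUnit_of_mul_isUnit_right h)

lemma mul_mem_nonunitsSubmodule_right (r : A) {a : A} (ha : a ∈ nonunitsSubmodule k A) :
    a * r ∈ nonunitsSubmodule k A :=
  fun h => ha (isUnit_of_mul_isUnit_left h)

lemma mem_jacobson_of_mem_nonunitsSubmodule {a : A} (ha : a ∈ nonunitsSubmodule k A) :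
    a ∈ Ideal.jacobson (⊥ : Ideal A) := by
  rw [Ideal.mem_jacobson_iff]
  intro y
  have hu : IsUnit (y * a + 1) := by
    have h : (y * a + 1) + -(y * a) = 1 := by abel
    refine (IsLocalRing.isUnit_or_isUnit_of_add_one h).resolve_right fun h' => ?_
    exact mul_mem_nonunitsSubmodule_left (k := k) y ha (by simpa using h')
  obtain ⟨z, hz⟩ := hu.exists_left_inv
  refine ⟨z, ?_⟩
  rw [Submodule.mem_bot, mul_assoc, sub_eq_zero, ← hz]
  noncomm_ring

variable (k A) in
/-- The elements of the maximal ideal which are annihilated by it on both sides. -/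
def annihilatedNonunits : Submodule k A where
  carrier := {x | x ∈ nonunitsSubmodule k A ∧
    ∀ j ∈ nonunitsSubmodule k A, j * x = 0 ∧ x * j = 0}
  zero_mem' := ⟨zero_mem _, fun j _ => ⟨mul_zero j, zero_mul j⟩⟩
  add_mem' {a b} ha hb := ⟨add_mem ha.1 hb.1, fun j hj => by
    rw [mul_add, add_mul, (ha.2 j hj).1, (ha.2 j hj).2, (hb.2 j hj).1, (hb.2 j hj).2, add_zero]
    exact ⟨rfl, rfl⟩⟩
  smul_mem' c a ha := ⟨Submodule.smul_mem _ c ha.1, fun j hj => by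
    rw [mul_smul_comm, smul_mul_assoc, (ha.2 j hj).1, (ha.2 j hj).2, smul_zero]
    exact ⟨rfl, rfl⟩⟩

lemma mul_mem_annihilatedNonunits_left (r : A) {a : A} (ha : a ∈ annihilatedNonunits k A) :
    r * a ∈ annihilatedNonunits k A :=
  ⟨mul_mem_nonunitsSubmodule_left r ha.1, fun j hj =>
    ⟨by rw [← mul_assoc, (ha.2 _ (mul_mem_nonunitsSubmodule_right r hj)).1],
      by rw [mul_assoc, (ha.2 j hj).2, mul_zero]⟩⟩

lemma mul_mem_annihilatedNonunits_right (r : A) {a : A} (ha : a ∈ annihilatedNonunits k A) :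
    a * r ∈ annihilatedNonunits k A :=
  ⟨mul_mem_nonunitsSubmodule_right r ha.1, fun j hj =>
    ⟨by rw [← mul_assoc, (ha.2 j hj).1, zero_mul],
      by rw [mul_assoc, (ha.2 _ (mul_mem_nonunitsSubmodule_left r hj)).2]⟩⟩

lemma mul_mem_annihilatedNonunits
    (hshort : ∀ x ∈ Ideal.jacobson (⊥ : Ideal A), ∀ y ∈ Ideal.jacobson (⊥ : Ideal A),
      ∀ z ∈ Ideal.jacobson (⊥ : Ideal A), x * y * z = 0) {a b : A}
    (ha : a ∈ nonunitsSubmodule k A) (hb : b ∈ nonunitsSubmodule k A) :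
    a * b ∈ annihilatedNonunits k A := by
  have ha' := mem_jacobson_of_mem_nonunitsSubmodule ha
  have hb' := mem_jacobson_of_mem_nonunitsSubmodule hb
  refine ⟨mul_mem_nonunitsSubmodule_left a hb, fun j hj => ?_⟩
  have hj' := mem_jacobson_of_mem_nonunitsSubmodule hj
  exact ⟨by rw [← mul_assoc, hshort j hj' a ha' b hb'], hshort a ha' b hb' j hj'⟩

theorem shortSide_left
    (hshort : ∀ x ∈ Ideal.jacobson (⊥ : Ideal A), ∀ y ∈ Ideal.jacobson (⊥ : Ideal A),
      ∀ z ∈ Ideal.jacobson (⊥ : Ideal A), x * y * z = 0) :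
    ShortSide k A A (nonunitsSubmodule k A) (annihilatedNonunits k A) where
  bijective := ⟨fun a b hab => by simpa using hab, fun a => ⟨a, by simp⟩⟩
  isUnit r hr := not_not.1 (by rwa [smul_eq_mul, mul_one] at hr)
  one_notMem h := h isUnit_one
  smul_mem r _ ha := mul_mem_nonunitsSubmodule_left r ha
  smul_mem_of_mem r a hr := by
    rw [smul_eq_mul, mul_one] at hr
    exact mul_mem_nonunitsSubmodule_right a hr
  smul_mem₂ r _ ha := mul_mem_annihilatedNonunits_left r ha
  smul_mem₂_of_mem r a hr ha := by
    rw [smul_eq_mul, mul_one] at hr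
    exact mul_mem_annihilatedNonunits hshort hr ha
  smul_eq_zero r a hr ha := by
    rw [smul_eq_mul, mul_one] at hr
    exact (ha.2 r hr).1
  smul_eq_zero' r a hr ha := by
    rw [smul_eq_mul, mul_one] at hr
    exact (hr.2 a ha).2
  le _ ha := ha.1

theorem shortSide_right
    (hshort : ∀ x ∈ Ideal.jacobson (⊥ : Ideal A), ∀ y ∈ Ideal.jacobson (⊥ : Ideal A),
      ∀ z ∈ Ideal.jacobson (⊥ : Ideal A), x * y * z = 0) :
    ShortSide k A Aᵐᵒᵖ (nonunitsSubmodule k A) (annihilatedNonunits k A) where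
  bijective := ⟨fun a b hab => by simpa using hab, fun a => ⟨MulOpposite.op a, by simp⟩⟩
  isUnit r hr := by
    have : IsUnit r.unop := not_not.1 (by rwa [MulOpposite.smul_eq_mul_unop, one_mul] at hr)
    exact isUnit_unop.1 this
  one_notMem h := h isUnit_one
  smul_mem r _ ha := mul_mem_nonunitsSubmodule_right r.unop ha
  smul_mem_of_mem r a hr := by
    rw [MulOpposite.smul_eq_mul_unop, one_mul] at hr
    exact mul_mem_nonunitsSubmodule_left a hr
  smul_mem₂ r _ ha := mul_mem_annihilatedNonunits_right r.unop ha
  smul_mem₂_of_mem r a hr ha := by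
    rw [MulOpposite.smul_eq_mul_unop, one_mul] at hr
    exact mul_mem_annihilatedNonunits hshort ha hr
  smul_eq_zero r a hr ha := by
    rw [MulOpposite.smul_eq_mul_unop, one_mul] at hr
    exact (ha.2 _ hr).2
  smul_eq_zero' r a hr ha := by
    rw [MulOpposite.smul_eq_mul_unop, one_mul] at hr
    exact (hr.2 a ha).1
  le _ ha := ha.1

end Local

/-- If all simple modules have the same length over the base ring, then lengths over the base
ring are proportional to lengths. -/
lemma length_eq_mul_length {k R S : Type u} [CommRing k] [Ring R] [Algebra k R]
    [AddCommGroup S] [Module R S] [Module k S] [IsScalarTower k R S]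
    (hS : ∀ (T : Type u) [AddCommGroup T] [Module R T] [IsSimpleModule R T],
      Nonempty (T ≃ₗ[R] S)) {X : Type u} [AddCommGroup X] [Module R X]
    (hX : IsFiniteLength R X) [Module k X] [IsScalarTower k R X] :
    Module.length k X = Module.length k S * Module.length R X := by
  revert ‹Module k X›
  induction hX with
  | of_subsingleton =>
    intro _ _
    rw [Module.length_eq_zero (R := k), Module.length_eq_zero (R := R), mul_zero]
  | @of_simple_quotient X _ _ N hN _ ih =>
    intro _ _
    obtain ⟨e⟩ := hS (X ⧸ N)
    have h₁ := Module.length_eq_add_of_exact (N.subtype.restrictScalars k)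
      (N.mkQ.restrictScalars k) N.injective_subtype N.mkQ_surjective
      (LinearMap.exact_subtype_mkQ N)
    have h₂ := Module.length_eq_add_of_exact N.subtype N.mkQ N.injective_subtype N.mkQ_surjective
      (LinearMap.exact_subtype_mkQ N)
    rw [h₁, h₂, ih, (e.restrictScalars k).length_eq, Module.length_eq_one_iff.2 hN, mul_add,
      mul_one]

namespace ShortSide

variable {k A R : Type u} [CommRing k] [Ring A] [Algebra k A] [Ring R]
  [Algebra k R] [Module R A] [IsScalarTower k R A] {J J₂ : Submodule k A}
  [IsArtinianRing k] [Module.Finite k A]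

lemma length_eq_of_klen_eq (h : ShortSide k A R J J₂) {X Y : Type u} [AddCommGroup X]
    [Module k X] [Module R X] [IsScalarTower k R X] [Module.Finite k X] [AddCommGroup Y]
    [Module k Y] [Module R Y] [IsScalarTower k R Y] [Module.Finite k Y]
    (hXY : klen k X = klen k Y) : Module.length R X = Module.length R Y := by
  have hfl : ∀ (Z : Type u) [AddCommGroup Z] [Module k Z] [Module R Z] [IsScalarTower k R Z]
      [Module.Finite k Z], IsFiniteLength R Z := fun Z _ _ _ _ _ =>
    isFiniteLength_iff_isNoetherian_isArtinian.2
      ⟨isNoetherian_of_tower k inferInstance, isArtinian_of_tower k inferInstance⟩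
  have hS := fun (T : Type u) [AddCommGroup T] [Module R T] [IsSimpleModule R T] =>
    h.nonempty_residue_equiv T
  have hlen : ∀ (Z : Type u) [AddCommGroup Z] [Module k Z] [Module R Z] [IsScalarTower k R Z]
      [Module.Finite k Z],
      klen k Z = klen k (A ⧸ h.maxIdeal) * (Module.length R Z).toNat := fun Z _ _ _ _ _ => by
    rw [klen, klen, length_eq_mul_length (k := k) hS (hfl Z), ENat.toNat_mul]
  have hpos : 0 < klen k (A ⧸ h.maxIdeal) := h.klen_residue_pos
  have hfin := fun (Z : Type u) [AddCommGroup Z] [Module k Z] [Module R Z] [IsScalarTower k R Z]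
      [Module.Finite k Z] => Module.length_ne_top_iff.2 (hfl Z)
  rw [← ENat.natCast_toNat (hfin X), ← ENat.natCast_toNat (hfin Y)]
  rw [hlen X, hlen Y] at hXY
  exact congrArg _ (Nat.eq_of_mul_eq_mul_left hpos hXY)

end ShortSide

/-- If source and target have the same length, then so do kernel and cokernel. -/
lemma klen_ker_eq_klen_coker {k R X Y : Type u} [CommRing k] [IsArtinianRing k] [Ring R]
    [Algebra k R] [AddCommGroup X] [Module k X] [Module R X] [IsScalarTower k R X]
    [Module.Finite k X] [AddCommGroup Y] [Module k Y] [Module R Y] [IsScalarTower k R Y]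
    [Module.Finite k Y] (f : X →ₗ[R] Y) (h : klen k X = klen k Y) :
    klen k (ker f) = klen k (Y ⧸ range f) := by
  have h₁ := klen_eq_ker_add_range (f.restrictScalars k)
  have h₂ := klen_eq_quotient_add (range (f.restrictScalars k))
  have h₃ : klen k (ker f) = klen k (ker (f.restrictScalars k)) := rfl
  have h₄ : klen k (Y ⧸ range f) = klen k (Y ⧸ range (f.restrictScalars k)) := rfl
  omega

/-- Proposition 4.2(b): over a short local artin algebra, if both `M` and `M^*` are
semi-Gorenstein-projective, then `Ker φ_M` and `Cok φ_M` have the same length; hence if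
`φ_M` is mono or epi it is an isomorphism and `M` is Gorenstein-projective. -/
theorem short_local_ker_coker_phi_same_length (k : Type u) [CommRing k] [IsArtinianRing k]
    (A : Type u) [Ring A] [Algebra k A] [Module.Finite k A] [IsLocalRing A]
    (hshort : ∀ x ∈ Ideal.jacobson (⊥ : Ideal A), ∀ y ∈ Ideal.jacobson (⊥ : Ideal A),
      ∀ z ∈ Ideal.jacobson (⊥ : Ideal A), x * y * z = 0)
    (M : Type u) [AddCommGroup M] [Module A M] [Module.Finite A M]
    (h1 : sGp A M) (h2 : sGpR A (Dl A M)) :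
    lengthM A (↥(ker (evalL A M))) = lengthM A ((Dr A (Dl A M)) ⧸ range (evalL A M)) ∧
    ((Function.Injective (evalL A M) ∨ Function.Surjective (evalL A M)) →
      (Function.Bijective (evalL A M) ∧ GorensteinProj A M)) := by
  let _ : Module k M := Module.compHom M (algebraMap k A)
  have : IsScalarTower k A M := ⟨fun c a m => by
    rw [Algebra.smul_def, mul_smul]
    rfl⟩
  have : Module.Finite k M := Module.Finite.trans A M
  have : IsArtinianRing A := isArtinian_of_tower k inferInstance
  have hL := shortSide_left (k := k) hshort
  have hR := shortSide_right (k := k) hshort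
  let X : KMod k A := { carrier := M }
  have htower : IsScalarTower k A (Dr A (Dl A M)) := isScalarTower_dr k A (Dl A M)
  have hfin : Module.Finite k (Dr A (Dl A M)) := (hR.dualR (hL.dualL X)).finite
  have hlen : klen k M = klen k (Dr A (Dl A M)) :=
    hL.klen_eq_klen_bidual hR X (fun n => extVanish_of_extZero (h1 (n + 1) (by omega)))
      fun n => extVanish_of_extZero (h2 (n + 1) (by omega))
  have hker : Module.Finite k (ker (evalL A M)) :=
    Module.Finite.of_injective ((ker (evalL A M)).subtype.restrictScalars k)
      (ker (evalL A M)).injective_subtype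
  have hcoker : Module.Finite k (Dr A (Dl A M) ⧸ range (evalL A M)) :=
    Module.Finite.of_surjective ((range (evalL A M)).mkQ.restrictScalars k)
      (range (evalL A M)).mkQ_surjective
  have hkc := klen_ker_eq_klen_coker (k := k) (evalL A M) hlen
  refine ⟨?_, fun hor => ?_⟩
  · rw [lengthM, lengthM, ← Module.coe_length, ← Module.coe_length, hL.length_eq_of_klen_eq hkc]
  have hinj : Function.Injective (evalL A M) ↔ klen k (ker (evalL A M)) = 0 := by
    rw [klen_eq_zero_iff, Submodule.subsingleton_iff_eq_bot, ker_eq_bot]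
  have hsurj : Function.Surjective (evalL A M) ↔
      klen k (Dr A (Dl A M) ⧸ range (evalL A M)) = 0 := by
    rw [klen_eq_zero_iff, Submodule.Quotient.subsingleton_iff, range_eq_top]
  have hbij : Function.Bijective (evalL A M) := by
    rw [← hkc] at hsurj
    rcases hor with h | h
    · exact ⟨h, hsurj.2 (hinj.1 h)⟩
    · exact ⟨hinj.2 (hsurj.1 h), h⟩
  exact ⟨hbij, h1, h2, hbij⟩
end
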